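/- arXiv:2512.08268 — 2 statements merged into one kernel-verified Lean document; each statement's English description precedes it below -/
import Mathlib

section
/- Success amplification for maximum distributional complexity: for every δ > 0, every (possibly partial) function f : X → {0,1} with X ⊆ {0,1}^m, and every success probability γ in the range (1+δ)/2 ≤ γ ≤ 1 − δ, the maximum distributional query complexity with the success-probability score satisfies R̄̄_{γ+δ/3}(f) ≤ 4·R̄̄_γ(f). -/
open Finset

/-- Deterministic decision trees querying coordinates `i : ι` of inputs `x : ι → Bool`,
with leaves labelled by elements of `L`. -/
inductive DTree (ι : Type) (L : Type) : Type
  | leaf (lab : L) : DTree ι L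
  | node (i : ι) (t0 : DTree ι L) (t1 : DTree ι L) : DTree ι L

namespace DTree

variable {ι L : Type}

/-- Output label at the leaf reached by input `x`. -/
def out : DTree ι L → (ι → Bool) → L
  | .leaf lab, _ => lab
  | .node i t0 t1, x => if x i then out t1 x else out t0 x

/-- Number of queries made on input `x` (depth of the leaf reached by `x`). -/
def cost : DTree ι L → (ι → Bool) → ℕ
  | .leaf _, _ => 0
  | .node i t0 t1, x => (if x i then cost t1 x else cost t0 x) + 1

/-- Maximum leaf depth of the tree. -/
def depth : DTree ι L → ℕ
  | .leaf _ => 0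
  | .node _ t0 t1 => max (depth t0) (depth t1) + 1

/-- The set of inputs reaching the same leaf as input `x`. -/
def leafSet : DTree ι L → (ι → Bool) → Set (ι → Bool)
  | .leaf _, _ => Set.univ
  | .node i t0 t1, x => {y | y i = x i} ∩ (if x i then leafSet t1 x else leafSet t0 x)

/-- Every leaf label of the tree satisfies the predicate `P`. -/
def allLabels : DTree ι L → (L → Prop) → Prop
  | .leaf lab, P => P lab
  | .node _ t0 t1, P => allLabels t0 P ∧ allLabels t1 P

end DTree

/-- A randomized query algorithm: a finitely supported probability distribution over
deterministic decision trees. -/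
structure RandAlg (ι : Type) (L : Type) where
  k : ℕ
  p : Fin k → ℝ
  T : Fin k → DTree ι L
  p_nonneg : ∀ j, 0 ≤ p j
  p_sum : ∑ j, p j = 1

/-- A probability distribution on inputs, supported inside the domain `X`. -/
structure InputDist (ι : Type) [Fintype ι] [DecidableEq ι] (X : Set (ι → Bool)) where
  μ : (ι → Bool) → ℝ
  nonneg : ∀ x, 0 ≤ μ x
  sum_one : ∑ x, μ x = 1
  supp : ∀ x, x ∉ X → μ x = 0

/-- A score function `φ : [0,1] → [1/2,1]`. -/
structure ScoreFun where
  φ : ℝ → ℝ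
  continuous : ContinuousOn φ (Set.Icc 0 1)
  half_le : ∀ p ∈ Set.Icc (0:ℝ) 1, 1 / 2 ≤ φ p
  le_one : ∀ p ∈ Set.Icc (0:ℝ) 1, φ p ≤ 1
  map_zero : φ 0 = 1
  map_one : φ 1 = 1
  map_half : φ (1 / 2) = 1 / 2
  symm : ∀ p ∈ Set.Icc (0:ℝ) 1, φ (1 - p) = φ p
  mono : MonotoneOn φ (Set.Icc (1 / 2) 1)

section Defs

variable {ι L : Type} [Fintype ι] [DecidableEq ι]

/-- Mass of a set of inputs under the weight function `μ`. -/
noncomputable def mass (μ : (ι → Bool) → ℝ) (S : Set (ι → Bool)) : ℝ :=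
  ∑ x, Set.indicator S μ x

/-- Score `φ(μ(ℓ₁)/μ(ℓ))` of the leaf `ℓ` reached by `x` in the tree `t`. -/
noncomputable def leafScore (S : ScoreFun) (f : (ι → Bool) → Bool) (μ : (ι → Bool) → ℝ)
    (t : DTree ι L) (x : ι → Bool) : ℝ :=
  S.φ (mass μ (t.leafSet x ∩ {y | f y = true}) / mass μ (t.leafSet x))

/-- Score of a randomized algorithm: `E_{D∼R, x∼μ}[score(D(x))]`. -/
noncomputable def algScore (S : ScoreFun) (f : (ι → Bool) → Bool) (μ : (ι → Bool) → ℝ)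
    (R : RandAlg ι L) : ℝ :=
  ∑ j, R.p j * ∑ x, μ x * leafScore S f μ (R.T j) x

/-- Expected cost `E_{D∼R, x∼μ}[cost(D(x))]`. -/
noncomputable def expCost (μ : (ι → Bool) → ℝ) (R : RandAlg ι L) : ℝ :=
  ∑ j, R.p j * ∑ x, μ x * ((R.T j).cost x : ℝ)

/-- Score-weighted cost `E[score(D(x))·cost(D(x))] / E[score(D(x))]`. -/
noncomputable def scost (S : ScoreFun) (f : (ι → Bool) → Bool) (μ : (ι → Bool) → ℝ)
    (R : RandAlg ι L) : ℝ :=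
  (∑ j, R.p j * ∑ x, μ x * (leafScore S f μ (R.T j) x * ((R.T j).cost x : ℝ))) /
    algScore S f μ R

/-- Discounted score `E[score(D(x))·e^{-α·cost(D(x))}]`. -/
noncomputable def dScore (S : ScoreFun) (f : (ι → Bool) → Bool) (μ : (ι → Bool) → ℝ)
    (α : ℝ) (R : RandAlg ι L) : ℝ :=
  ∑ j, R.p j * ∑ x, μ x *
    (leafScore S f μ (R.T j) x * Real.exp (-(α * ((R.T j).cost x : ℝ))))

/-- Maximum discounted score `DS_α^μ(f)`. -/
noncomputable def DS (S : ScoreFun) (f : (ι → Bool) → Bool) (μ : (ι → Bool) → ℝ)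
    (α : ℝ) : ℝ :=
  ⨆ R : RandAlg ι Unit, dScore S f μ α R

/-- Distributional score-weighted query complexity `sR̄̄_γ^μ(f)`. -/
noncomputable def sRdist (S : ScoreFun) (f : (ι → Bool) → Bool) (μ : (ι → Bool) → ℝ)
    (γ : ℝ) : ℝ :=
  sInf {c | ∃ R : RandAlg ι Unit, γ ≤ algScore S f μ R ∧ scost S f μ R = c}

/-- Distributional query complexity `R̄̄_γ^μ(f)` (expected cost). -/
noncomputable def Rdist (S : ScoreFun) (f : (ι → Bool) → Bool) (μ : (ι → Bool) → ℝ)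
    (γ : ℝ) : ℝ :=
  sInf {c | ∃ R : RandAlg ι Unit, γ ≤ algScore S f μ R ∧ expCost μ R = c}

/-- Maximum score-weighted distributional query complexity `sR̄̄_γ(f)`. -/
noncomputable def sRmax (S : ScoreFun) (X : Set (ι → Bool)) (f : (ι → Bool) → Bool)
    (γ : ℝ) : ℝ :=
  ⨆ μ : InputDist ι X, sRdist S f μ.μ γ

/-- Maximum distributional query complexity `R̄̄_γ(f)`. -/
noncomputable def Rmax (S : ScoreFun) (X : Set (ι → Bool)) (f : (ι → Bool) → Bool)
    (γ : ℝ) : ℝ :=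
  ⨆ μ : InputDist ι X, Rdist S f μ.μ γ

/-- Success-probability score `max{μ(ℓ₀),μ(ℓ₁)}/μ(ℓ)` of the leaf reached by `x`. -/
noncomputable def succLeafScore (f : (ι → Bool) → Bool) (μ : (ι → Bool) → ℝ)
    (t : DTree ι L) (x : ι → Bool) : ℝ :=
  max (mass μ (t.leafSet x ∩ {y | f y = false})) (mass μ (t.leafSet x ∩ {y | f y = true})) /
    mass μ (t.leafSet x)

/-- Success-probability score of a randomized algorithm. -/
noncomputable def succAlgScore (f : (ι → Bool) → Bool) (μ : (ι → Bool) → ℝ)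
    (R : RandAlg ι L) : ℝ :=
  ∑ j, R.p j * ∑ x, μ x * succLeafScore f μ (R.T j) x

/-- Distributional query complexity with the success-probability score. -/
noncomputable def succRdist (f : (ι → Bool) → Bool) (μ : (ι → Bool) → ℝ) (γ : ℝ) : ℝ :=
  sInf {c | ∃ R : RandAlg ι Unit, γ ≤ succAlgScore f μ R ∧ expCost μ R = c}

/-- Maximum distributional query complexity `R̄̄_γ(f)` with the success-probability score. -/
noncomputable def succRmax (X : Set (ι → Bool)) (f : (ι → Bool) → Bool) (γ : ℝ) : ℝ :=
  ⨆ μ : InputDist ι X, succRdist f μ.μ γ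

/-- The fraction `q = μ(ℓ₁)/μ(ℓ)` at the leaf reached by `x`. -/
noncomputable def leafBias (f : (ι → Bool) → Bool) (μ : (ι → Bool) → ℝ)
    (t : DTree ι L) (x : ι → Bool) : ℝ :=
  mass μ (t.leafSet x ∩ {y | f y = true}) / mass μ (t.leafSet x)

/-- Hellinger loss `E[2·√(q(1-q))]` of a randomized algorithm. -/
noncomputable def helLossAlg (f : (ι → Bool) → Bool) (μ : (ι → Bool) → ℝ)
    (R : RandAlg ι L) : ℝ :=
  ∑ j, R.p j * ∑ x, μ x *
    (2 * Real.sqrt (leafBias f μ (R.T j) x * (1 - leafBias f μ (R.T j) x)))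

/-- Hellinger score `E[1 - √(q(1-q))]` of a randomized algorithm. -/
noncomputable def helScoreAlg (f : (ι → Bool) → Bool) (μ : (ι → Bool) → ℝ)
    (R : RandAlg ι L) : ℝ :=
  ∑ j, R.p j * ∑ x, μ x *
    (1 - Real.sqrt (leafBias f μ (R.T j) x * (1 - leafBias f μ (R.T j) x)))

/-- `R̄̄_{Hel↓,ε}(f)`: maximum distributional complexity at Hellinger loss `ε`. -/
noncomputable def RmaxHelLoss (X : Set (ι → Bool)) (f : (ι → Bool) → Bool) (ε : ℝ) : ℝ :=
  ⨆ μ : InputDist ι X,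
    sInf {c | ∃ R : RandAlg ι Unit, helLossAlg f μ.μ R ≤ ε ∧ expCost μ.μ R = c}

/-- `R̄̄_{Hel,γ}(f)`: maximum distributional complexity at Hellinger score `γ`. -/
noncomputable def RmaxHel (X : Set (ι → Bool)) (f : (ι → Bool) → Bool) (γ : ℝ) : ℝ :=
  ⨆ μ : InputDist ι X,
    sInf {c | ∃ R : RandAlg ι Unit, γ ≤ helScoreAlg f μ.μ R ∧ expCost μ.μ R = c}

/-- Binary entropy function. -/
noncomputable def binEnt (p : ℝ) : ℝ :=
  -(p * Real.logb 2 p) - (1 - p) * Real.logb 2 (1 - p)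

/-- Exponential-entropy score `E[1 - (1/2)·2^{-h(q)}]` of a randomized algorithm. -/
noncomputable def entScoreAlg (f : (ι → Bool) → Bool) (μ : (ι → Bool) → ℝ)
    (R : RandAlg ι L) : ℝ :=
  ∑ j, R.p j * ∑ x, μ x *
    (1 - (1 / 2) * (2:ℝ) ^ (-(binEnt (leafBias f μ (R.T j) x))))

/-- `R̄̄_{Ent,γ}(f)`: maximum distributional complexity at exponential-entropy score `γ`. -/
noncomputable def RmaxEnt (X : Set (ι → Bool)) (f : (ι → Bool) → Bool) (γ : ℝ) : ℝ :=
  ⨆ μ : InputDist ι X,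
    sInf {c | ∃ R : RandAlg ι Unit, γ ≤ entScoreAlg f μ.μ R ∧ expCost μ.μ R = c}

end Defs

section WorstCase

variable {ι L : Type}

open Classical in
/-- Worst-case randomized query complexity for a generic task: minimum, over randomized
algorithms whose leaf labels satisfy `labelOK` and which on every input `x ∈ X` output a
label `z` with `good x z` with probability at least `δ`, of the maximum leaf depth over
the trees in the support. -/
noncomputable def RwcTask (X : Set (ι → Bool)) (good : (ι → Bool) → L → Prop)
    (labelOK : L → Prop) (δ : ℝ) : ℕ :=
  sInf {d : ℕ | ∃ R : RandAlg ι L,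
    (∀ j, R.p j ≠ 0 → (R.T j).allLabels labelOK) ∧
    (∀ x ∈ X, δ ≤ ∑ j, if good x ((R.T j).out x) then R.p j else 0) ∧
    ∀ j, R.p j ≠ 0 → (R.T j).depth ≤ d}

/-- Worst-case randomized query complexity `R_δ(f)` of a (partial) Boolean function. -/
noncomputable def Rwc (X : Set (ι → Bool)) (f : (ι → Bool) → Bool) (δ : ℝ) : ℕ :=
  RwcTask X (fun x b => b = f x) (fun _ : Bool => True) δ

end WorstCase

section Product

variable {m n : ℕ} {L : Type}

/-- The `i`-th block of an input to the `n`-fold direct product. -/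
def block (x : Fin n × Fin m → Bool) (i : Fin n) : Fin m → Bool := fun j => x (i, j)

/-- The product domain `Xⁿ`. -/
def Xpow (n : ℕ) (X : Set (Fin m → Bool)) : Set (Fin n × Fin m → Bool) :=
  {x | ∀ i, block x i ∈ X}

/-- The `n`-fold direct product `fⁿ`. -/
def fpow (f : (Fin m → Bool) → Bool) (x : Fin n × Fin m → Bool) : Fin n → Bool :=
  fun i => f (block x i)

/-- The product distribution `μⁿ`. -/
noncomputable def prodMu (μ : (Fin m → Bool) → ℝ) (x : Fin n × Fin m → Bool) : ℝ :=
  ∏ i, μ (block x i)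

/-- The `i`-th factor `ℓ^(i)` of the (product) leaf reached by `x` in a decision tree for `fⁿ`. -/
def blockSet (t : DTree (Fin n × Fin m) L) (x : Fin n × Fin m → Bool) (i : Fin n) :
    Set (Fin m → Bool) :=
  {y | (fun q : Fin n × Fin m => if q.1 = i then y q.2 else x q) ∈ t.leafSet x}

/-- Score of a leaf of a tree for `fⁿ` under `μⁿ`: the product of the scores of its factors. -/
noncomputable def prodLeafScore (S : ScoreFun) (f : (Fin m → Bool) → Bool)
    (μ : (Fin m → Bool) → ℝ) (t : DTree (Fin n × Fin m) L) (x : Fin n × Fin m → Bool) : ℝ :=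
  ∏ i, S.φ (mass μ (blockSet t x i ∩ {y | f y = true}) / mass μ (blockSet t x i))

/-- Score of a randomized algorithm for `fⁿ` under `μⁿ`. -/
noncomputable def algScoreN (S : ScoreFun) (f : (Fin m → Bool) → Bool)
    (μ : (Fin m → Bool) → ℝ) (R : RandAlg (Fin n × Fin m) L) : ℝ :=
  ∑ j, R.p j * ∑ x, prodMu μ x * prodLeafScore S f μ (R.T j) x

/-- Score-weighted cost of a randomized algorithm for `fⁿ` under `μⁿ`. -/
noncomputable def scostN (S : ScoreFun) (f : (Fin m → Bool) → Bool)
    (μ : (Fin m → Bool) → ℝ) (R : RandAlg (Fin n × Fin m) L) : ℝ :=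
  (∑ j, R.p j * ∑ x, prodMu μ x * (prodLeafScore S f μ (R.T j) x * ((R.T j).cost x : ℝ))) /
    algScoreN S f μ R

/-- Discounted score of a randomized algorithm for `fⁿ` under `μⁿ`. -/
noncomputable def dScoreN (S : ScoreFun) (f : (Fin m → Bool) → Bool)
    (μ : (Fin m → Bool) → ℝ) (α : ℝ) (R : RandAlg (Fin n × Fin m) L) : ℝ :=
  ∑ j, R.p j * ∑ x, prodMu μ x *
    (prodLeafScore S f μ (R.T j) x * Real.exp (-(α * ((R.T j).cost x : ℝ))))

/-- Maximum discounted score `DS_α^{μⁿ}(fⁿ)`. -/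
noncomputable def DSN (S : ScoreFun) (f : (Fin m → Bool) → Bool)
    (μ : (Fin m → Bool) → ℝ) (α : ℝ) (n : ℕ) : ℝ :=
  ⨆ R : RandAlg (Fin n × Fin m) Unit, dScoreN S f μ α R

/-- Distributional score-weighted query complexity `sR̄̄_γ^{μⁿ}(fⁿ)`. -/
noncomputable def sRdistN (S : ScoreFun) (f : (Fin m → Bool) → Bool)
    (μ : (Fin m → Bool) → ℝ) (γ : ℝ) (n : ℕ) : ℝ :=
  sInf {c | ∃ R : RandAlg (Fin n × Fin m) Unit,
    γ ≤ algScoreN S f μ R ∧ scostN S f μ R = c}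

/-- Worst-case randomized query complexity `R_δ(fⁿ)` of computing `fⁿ` exactly. -/
noncomputable def RwcN (X : Set (Fin m → Bool)) (f : (Fin m → Bool) → Bool)
    (n : ℕ) (δ : ℝ) : ℕ :=
  RwcTask (Xpow n X) (fun x z => z = fpow f x) (fun _ : Fin n → Bool => True) δ

/-- Success-probability score `max_z μ(ℓ ∩ (fⁿ)⁻¹(z))/μ(ℓ)` of a leaf of a tree for `fⁿ`
under an arbitrary distribution `μ` on `Xⁿ`. -/
noncomputable def succLeafScoreN (f : (Fin m → Bool) → Bool)
    (μ : (Fin n × Fin m → Bool) → ℝ) (t : DTree (Fin n × Fin m) L)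
    (x : Fin n × Fin m → Bool) : ℝ :=
  (⨆ z : Fin n → Bool, mass μ (t.leafSet x ∩ {y | fpow f y = z})) / mass μ (t.leafSet x)

/-- Success-probability score of a randomized algorithm for `fⁿ`. -/
noncomputable def succAlgScoreN (f : (Fin m → Bool) → Bool)
    (μ : (Fin n × Fin m → Bool) → ℝ) (R : RandAlg (Fin n × Fin m) L) : ℝ :=
  ∑ j, R.p j * ∑ x, μ x * succLeafScoreN f μ (R.T j) x

/-- Score-weighted cost of a randomized algorithm for `fⁿ` (success-probability score). -/
noncomputable def succScostN (f : (Fin m → Bool) → Bool)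
    (μ : (Fin n × Fin m → Bool) → ℝ) (R : RandAlg (Fin n × Fin m) L) : ℝ :=
  (∑ j, R.p j * ∑ x, μ x * (succLeafScoreN f μ (R.T j) x * ((R.T j).cost x : ℝ))) /
    succAlgScoreN f μ R

/-- Maximum score-weighted distributional query complexity `sR̄̄_δ(fⁿ)`
(success-probability score). -/
noncomputable def succSRmaxN (X : Set (Fin m → Bool)) (f : (Fin m → Bool) → Bool)
    (n : ℕ) (δ : ℝ) : ℝ :=
  ⨆ μ : InputDist (Fin n × Fin m) (Xpow n X),
    sInf {c | ∃ R : RandAlg (Fin n × Fin m) Unit,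
      δ ≤ succAlgScoreN f μ.μ R ∧ succScostN f μ.μ R = c}

/-- Worst-case randomized query complexity of the list-decoding task `LD_ℓⁿ ∘ f`. -/
noncomputable def RwcLD (X : Set (Fin m → Bool)) (f : (Fin m → Bool) → Bool)
    (n ℓ : ℕ) (δ : ℝ) : ℕ :=
  RwcTask (Xpow n X) (fun x S => fpow f x ∈ S)
    (fun S : Finset (Fin n → Bool) => S.card = 2 ^ (n - ℓ)) δ

open Classical in
/-- Worst-case randomized query complexity of the threshold task `Thr_kⁿ ∘ f`. -/
noncomputable def RwcThr (X : Set (Fin m → Bool)) (f : (Fin m → Bool) → Bool)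
    (n k : ℕ) (δ : ℝ) : ℕ :=
  RwcTask (Xpow n X)
    (fun x z => k ≤ (Finset.univ.filter fun i => z i = fpow f x i).card)
    (fun _ : Fin n → Bool => True) δ

open Classical in
/-- Worst-case randomized query complexity of the labelled threshold task `Label_kⁿ ∘ f`. -/
noncomputable def RwcLabel (X : Set (Fin m → Bool)) (f : (Fin m → Bool) → Bool)
    (n k : ℕ) (δ : ℝ) : ℕ :=
  RwcTask (Xpow n X)
    (fun x z => ∀ i b, z i = some b → fpow f x i = b)
    (fun z : Fin n → Option Bool =>
      (Finset.univ.filter fun i => (z i).isSome).card = k) δ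

end Product

theorem quadratic_nonneg_of_le_third {ε g d t B : ℝ} (hg : 0 < g) (h3 : 3 * g ≤ ε) (hε : ε ≤ 1 / 3)
    (hd : 0 ≤ d) (hd' : d ≤ 4 * g / 3) (ht : t = ε - g + d)
    (hB : B = ε * (1 - ε) * (1 - 2 * ε) - g * (1 - 2 * ε + 2 * ε ^ 2) - ε * (1 - 2 * ε) * d)
    (hB0 : B ≤ 0) : 0 ≤ d ^ 2 / 4 + t * B := by
  have hε0 : 0 < ε := by linarith
  have ht0 : 0 ≤ t := by linarith
  have e1 : 0 ≤ ε * (1 - 2 * ε) := mul_nonneg hε0.le (by linarith)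
  have e2 : g * (2 - 7 * ε + 4 * ε ^ 2) ≤ ε / 3 * (2 - 7 * ε + 4 * ε ^ 2) :=
    mul_le_mul_of_nonneg_right (by linarith) (by nlinarith)
  have e3 : (ε / 3 - g) * (1 / 2) ≤ (ε / 3 - g) * (1 - 2 * ε + 2 * ε ^ 2) :=
    mul_le_mul_of_nonneg_left (by nlinarith [sq_nonneg (1 - 2 * ε)]) (by linarith)
  have e4 : g * (2 - 7 * ε + 4 * ε ^ 2) - ε * (1 - 2 * ε) * d
      + (ε / 3 - g) * (1 / 2) ≤ B := by rw [hB]; linarith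
  have e5 : ε * (1 - 2 * ε) ≤ 1 / 8 := by linarith [sq_nonneg (1 - 4 * ε)]
  have e6 : (1 / 9 : ℝ) ≤ 2 - 7 * ε + 4 * ε ^ 2 := by nlinarith
  have hdg : 8 / 9 * g ≤ d := by
    linarith [mul_le_mul_of_nonneg_left e6 hg.le, mul_le_mul_of_nonneg_right e5 hd]
  have e7 : -(1 / 27 : ℝ) ≤ 2 - 7 * ε + 4 * ε ^ 2 - ε * (1 - 2 * ε) * (4 / 3) := by nlinarith
  have e8 : -(g / 27) + (ε / 3 - g) / 2 ≤ B := by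
    linarith [mul_le_mul_of_nonneg_left e7 hg.le, mul_le_mul_of_nonneg_left hd' e1]
  have e10 : t ≤ 4 * g := by linarith
  have e11 : -(g / 27) * (4 * g) ≤ t * B := by
    linarith [mul_le_mul_of_nonneg_left (show -(g / 27) ≤ B by linarith) ht0,
      mul_le_mul_of_nonneg_left e10 (show 0 ≤ g / 27 by linarith)]
  linarith [mul_self_le_mul_self (by linarith) hdg, sq_nonneg g]

theorem quadratic_nonneg_of_third_le {ε g d t B : ℝ} (hg : 0 < g) (h4 : 3 * g ≤ 1 - 2 * ε)
    (hε : 1 / 3 ≤ ε)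
    (hd : 0 ≤ d) (hd' : d ≤ 4 * g / 3) (ht : t = ε - g + d)
    (hB : B = ε * (1 - ε) * (1 - 2 * ε) - g * (1 - 2 * ε + 2 * ε ^ 2) - ε * (1 - 2 * ε) * d)
    (hB0 : B ≤ 0) : 0 ≤ d ^ 2 / 4 + t * B := by
  have ht0 : 0 ≤ t := by linarith
  have e5 : ε * (1 - 2 * ε) ≤ 1 / 8 := by linarith [sq_nonneg (1 - 4 * ε)]
  have e1 : 0 ≤ ε * (1 - 2 * ε) := mul_nonneg (by linarith) (by linarith)
  obtain ⟨y, hy⟩ : ∃ y, y = (1 - 2 * ε) / 3 - g := ⟨_, rfl⟩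
  have hy0 : 0 ≤ y := by linarith
  have e2 : B = 3 * y * (ε * (1 - ε)) + g * (5 * ε - 5 * ε ^ 2 - 1) - ε * (1 - 2 * ε) * d := by
    rw [hB, hy]; ring
  have e3 : (2 / 9 : ℝ) ≤ ε * (1 - ε) := by nlinarith
  have e4 : -(1 / 27 : ℝ) + 17 / 10 * (ε - 1 / 3) ≤ -1 + 11 * ε / 3 - 7 * ε ^ 2 / 3 := by
    nlinarith
  have e6 : g * (-(1 / 27 : ℝ) + 17 / 10 * (ε - 1 / 3)) + 2 / 3 * y ≤ B := by
    linarith [mul_le_mul_of_nonneg_left e4 hg.le, mul_le_mul_of_nonneg_left e3 hy0,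
      mul_le_mul_of_nonneg_left hd' e1]
  rcases le_total g (47 / 500) with hg' | hg'
  · have e7 : 0 ≤ g * (-(1 / 27 : ℝ) + 17 / 10 * (ε - 1 / 3)) + 2 / 3 * y := by
      rw [show ε = 1 / 2 - 3 / 2 * (y + g) by linarith]
      linarith [mul_nonneg hy0 (sub_nonneg.2 hg'), mul_nonneg hg.le (sub_nonneg.2 hg')]
    rw [le_antisymm hB0 (e7.trans e6)]
    positivity
  · have e8 : (1 / 9 : ℝ) ≤ 5 * ε - 5 * ε ^ 2 - 1 := by nlinarith
    have hdg : 8 / 9 * g ≤ d := by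
      linarith [mul_le_mul_of_nonneg_left e8 hg.le, mul_le_mul_of_nonneg_left e3 hy0,
        mul_le_mul_of_nonneg_right e5 hd]
    have e9 : -(g / 27) ≤ B := by
      linarith [mul_le_mul_of_nonneg_left (sub_nonneg.2 hε) hg.le]
    have e11 : -(g / 27) * (1 / 2) ≤ t * B := by
      linarith [mul_le_mul_of_nonneg_left e9 ht0,
        mul_le_mul_of_nonneg_left (show t ≤ 1 / 2 by linarith) (show 0 ≤ g / 27 by linarith)]
    linarith [mul_self_le_mul_self (by linarith) hdg, mul_le_mul_of_nonneg_left hg' hg.le]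

theorem race_polynomial_nonneg {ε g d : ℝ} (hg : 0 < g) (h3 : 3 * g ≤ ε) (h4 : 3 * g ≤ 1 - 2 * ε)
    (hd : 0 ≤ d) (hd' : d ≤ 4 * g / 3) :
    0 ≤ (ε - g + d / 2) ^ 2 - 2 * ε * (ε - g + d / 2) * (ε - g + d)
      + 2 * ε ^ 2 * (ε - g + d) ^ 2 - ε ^ 2 * (ε - g + d) := by
  obtain ⟨t, ht⟩ : ∃ t, t = ε - g + d := ⟨_, rfl⟩
  obtain ⟨B, hB⟩ : ∃ B, B = ε * (1 - ε) * (1 - 2 * ε) - g * (1 - 2 * ε + 2 * ε ^ 2)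
    - ε * (1 - 2 * ε) * d := ⟨_, rfl⟩
  have key : 0 ≤ d ^ 2 / 4 + t * B := by
    rcases le_total 0 B with hB0 | hB0
    · have : 0 ≤ t := by linarith
      positivity
    rcases le_total ε (1 / 3) with h | h
    · exact quadratic_nonneg_of_le_third hg h3 h hd hd' ht hB hB0
    · exact quadratic_nonneg_of_third_le hg h4 h hd hd' ht hB hB0
  rw [ht, hB] at key
  linarith

/-- Suppose an algorithm has error `e` and cost `c` with a bound on a suitable combination of both.
Then the algorithm that repeats pairs of runs until two runs of a pair agree has error plus `l` times
cost at most `ε - g + 4 * (l * C)`. The inequality is this bound with denominators cleared. -/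
theorem race_step {ε g l C e c : ℝ} (hg : 0 < g) (h3 : 3 * g ≤ ε) (h4 : 3 * g ≤ 1 - 2 * ε)
    (hl : 0 < l) (hC : 0 ≤ C) (hL : 3 * (l * C) ≤ g) (he : 0 ≤ e) (hc : 0 ≤ c)
    (hec : e + 2 * ε * l / (ε - g + 2 * (l * C)) * c ≤
      ε + 2 * ε * l / (ε - g + 2 * (l * C)) * C) :
    e ^ 2 + 2 * l * c ≤ (ε - g + 4 * (l * C)) * (1 - 2 * e * (1 - e)) := by
  have hL0 : 0 ≤ l * C := by positivity
  have hε : 0 < ε := by linarith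
  have key := race_polynomial_nonneg hg h3 h4 (d := 4 * (l * C)) (by linarith) (by linarith)
  obtain ⟨s, hs⟩ : ∃ s, s = ε - g + 2 * (l * C) := ⟨_, rfl⟩
  obtain ⟨t, ht⟩ : ∃ t, t = ε - g + 4 * (l * C) := ⟨_, rfl⟩
  rw [← hs] at hec
  rw [← ht]
  rw [show ε - g + 4 * (l * C) / 2 = s by linarith, ← ht] at key
  have hs0 : 0 < s := by linarith
  have ht0 : 0 < t := by linarith
  have ht1 : t ≤ 1 / 2 := by linarith
  have h1 : s * e + 2 * ε * l * c ≤ ε * t := by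
    have := mul_le_mul_of_nonneg_left hec hs0.le
    have e1 : s * (e + 2 * ε * l / s * c) = s * e + 2 * ε * l * c := by field_simp
    have e2 : s * (ε + 2 * ε * l / s * C) = ε * s + 2 * ε * (l * C) := by field_simp
    rw [e1, e2] at this
    have e3 : ε * t = ε * s + 2 * ε * (l * C) := by rw [ht, hs]; ring
    linarith
  have h2 : s * e ≤ ε * t := by
    have : 0 ≤ 2 * ε * l * c := by positivity
    linarith
  have h3 : 0 ≤ s - 2 * ε * t - ε * (1 - 2 * t) * e := by
    have : 0 ≤ s * (s - 2 * ε * t - ε * (1 - 2 * t) * e) := by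
      have := mul_le_mul_of_nonneg_left h2 (mul_nonneg hε.le (by linarith : 0 ≤ 1 - 2 * t))
      linarith
    exact nonneg_of_mul_nonneg_right this hs0
  have h4 := mul_nonneg he h3
  have : 0 ≤ ε * (t * (1 - 2 * e * (1 - e)) - (e ^ 2 + 2 * l * c)) := by linarith
  linarith [nonneg_of_mul_nonneg_right this hε]

/-- **Minimax principle**: if every weighted average of finitely many convex functions can be made
smaller than the average of the thresholds `b`, then all the functions can be made smaller than
their thresholds simultaneously. -/
theorem exists_forall_lt_of_forall_weights {E κ : Type*} [AddCommGroup E] [Module ℝ E] [Fintype κ]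
    [Nonempty κ] {P : Set E} {φ : κ → E → ℝ} (hφ : ∀ i, ConvexOn ℝ P (φ i)) {b : κ → ℝ}
    (h : ∀ w : κ → ℝ, (∀ i, 0 ≤ w i) → ∑ i, w i = 1 →
      ∃ v ∈ P, ∑ i, w i * φ i v < ∑ i, w i * b i) :
    ∃ v ∈ P, ∀ i, φ i v < b i := by
  classical
  obtain ⟨i₀⟩ := ‹Nonempty κ›
  have hP : Convex ℝ P := (hφ i₀).1
  obtain ⟨v₀, hv₀, -⟩ := h (Pi.single i₀ 1)
    (Pi.single_nonneg.2 zero_le_one : (0 : κ → ℝ) ≤ Pi.single i₀ 1) (by simp)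
  by_contra! hcon
  have hA : Convex ℝ {y : κ → ℝ | ∀ i, y i < b i} := by
    rw [Set.ofPred_forall]
    exact convex_iInter fun i => convex_halfSpace_lt (LinearMap.proj i).isLinear _
  have hA' : IsOpen {y : κ → ℝ | ∀ i, y i < b i} := by
    rw [Set.ofPred_forall]
    exact isOpen_iInter_of_finite fun i => isOpen_lt (continuous_apply i) continuous_const
  have hB : Convex ℝ {y : κ → ℝ | ∃ v ∈ P, ∀ i, φ i v ≤ y i} := by
    rintro y ⟨v, hv, hvy⟩ y' ⟨v', hv', hvy'⟩ s t hs ht hst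
    refine ⟨s • v + t • v', hP hv hv' hs ht hst, fun i => ((hφ i).2 hv hv' hs ht hst).trans ?_⟩
    simp only [smul_eq_mul, Pi.add_apply, Pi.smul_apply]
    gcongr
    exacts [hvy i, hvy' i]
  obtain ⟨F, u, hFA, hFB⟩ := geometric_hahn_banach_open hA hA' hB (by
    rw [Set.disjoint_left]
    rintro y hy ⟨v, hv, hvy⟩
    obtain ⟨i, hi⟩ := hcon v hv
    exact absurd ((hvy i).trans_lt (hy i)) hi.not_gt)
  set w : κ → ℝ := fun i => F (Pi.single i 1) with hw
  have hF (y : κ → ℝ) : F y = ∑ i, w i * y i := by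
    conv_lhs => rw [← univ_sum_single y]
    rw [map_sum]
    refine sum_congr rfl fun i _ => ?_
    have : Pi.single i (y i) = y i • (Pi.single i 1 : κ → ℝ) := by
      rw [← Pi.single_smul', smul_eq_mul, mul_one]
    rw [this, map_smul, smul_eq_mul, mul_comm]
  have hw0 (i : κ) : 0 ≤ w i := by
    by_contra! hi
    have h0 := hFA (fun j => b j - 1) fun j => by simp
    have h1 := hFA ((fun j => b j - 1) - ((u - F (fun j => b j - 1)) / (-w i)) • Pi.single i 1)
      fun j => by
        have h2 : 0 ≤ (u - F (fun j => b j - 1)) / (-w i) :=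
          div_nonneg (by linarith) (by linarith)
        have h3 : 0 ≤ (Pi.single i 1 : κ → ℝ) j :=
          (Pi.single_nonneg.2 zero_le_one : (0 : κ → ℝ) ≤ Pi.single i 1) j
        have := mul_nonneg h2 h3
        simp only [Pi.sub_apply, Pi.smul_apply, smul_eq_mul]
        linarith
    rw [map_sub, map_smul, smul_eq_mul] at h1
    change _ - _ * w i < u at h1
    have : (u - F (fun j => b j - 1)) / (-w i) * w i = -(u - F (fun j => b j - 1)) := by
      rw [div_neg, neg_mul, div_mul_cancel₀ _ hi.ne]
    linarith
  have hb : F b ≤ u := by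
    refine le_of_forall_pos_lt_add fun ε hε => ?_
    have hW : 0 ≤ ∑ i, w i := sum_nonneg fun i _ => hw0 i
    have h1 := hFA (fun j => b j - ε / (∑ i, w i + 1)) fun j => by
      have : 0 < ε / (∑ i, w i + 1) := by positivity
      simpa
    have h2 : F (fun j => b j - ε / (∑ i, w i + 1)) = F b - ε * ((∑ i, w i) / (∑ i, w i + 1)) := by
      rw [hF, hF]
      simp only [mul_sub, sum_sub_distrib, ← sum_mul]
      ring
    have h3 : (∑ i, w i) / (∑ i, w i + 1) < 1 := (div_lt_one (by positivity)).2 (by linarith)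
    have := mul_lt_mul_of_pos_left h3 hε
    linarith
  have hW : 0 < ∑ i, w i := by
    refine lt_of_le_of_ne (sum_nonneg fun i _ => hw0 i) fun h0 => ?_
    have hw' := (sum_eq_zero_iff_of_nonneg fun i _ => hw0 i).1 h0.symm
    have hF0 (y : κ → ℝ) : F y = 0 := by
      rw [hF]
      exact sum_eq_zero fun i hi => by rw [hw' i hi, zero_mul]
    have h1 := hFA (fun j => b j - 1) fun j => by simp
    have h2 := hFB (fun i => φ i v₀) ⟨v₀, hv₀, fun i => le_rfl⟩
    rw [hF0] at h1 h2
    linarith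
  obtain ⟨v, hv, hlt⟩ := h (fun i => w i / ∑ j, w j) (fun i => div_nonneg (hw0 i) hW.le)
    (by rw [← sum_div, div_self hW.ne'])
  have h2 := hFB (fun i => φ i v) ⟨v, hv, fun i => le_rfl⟩
  have h3 : ∑ i, w i * φ i v < ∑ i, w i * b i := by
    simpa only [div_mul_eq_mul_div, ← sum_div, div_lt_div_iff_of_pos_right hW] using hlt
  rw [← hF, ← hF] at h3
  linarith

namespace DTree

variable {ι L : Type}

/-- Continue at every leaf of a labelled tree with `t0` or `t1`, according to the leaf label. -/
def graft (t0 t1 : DTree ι L) : DTree ι Bool → DTree ι L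
  | .leaf b => if b then t1 else t0
  | .node i s0 s1 => .node i (graft t0 t1 s0) (graft t0 t1 s1)

theorem out_graft (t0 t1 : DTree ι L) (t : DTree ι Bool) (x : ι → Bool) :
    (graft t0 t1 t).out x = if t.out x then t1.out x else t0.out x := by
  induction t with
  | leaf b => cases b <;> rfl
  | node i s0 s1 h0 h1 => by_cases h : x i <;> simp [graft, out, h, h0, h1]

theorem cost_graft (t0 t1 : DTree ι L) (t : DTree ι Bool) (x : ι → Bool) :
    (graft t0 t1 t).cost x = t.cost x + if t.out x then t1.cost x else t0.cost x := by
  induction t with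
  | leaf b => cases b <;> simp [graft, cost, out]
  | node i s0 s1 h0 h1 => by_cases h : x i <;> simp [graft, out, cost, h, h0, h1] <;> ring

/-- The acceptance indicator and the cost of a labelled tree, as functions of the input. -/
def profile (t : DTree ι Bool) : ((ι → Bool) → ℝ) × ((ι → Bool) → ℝ) :=
  (fun x => if t.out x then 1 else 0, fun x => t.cost x)

/-- A function depending only on the coordinates in `l` is computed by a tree that makes at most
`l.length` queries. -/
theorem exists_out_eq_of_list [DecidableEq ι] (l : List ι) (g : (ι → Bool) → L)
    (hg : ∀ x y, (∀ i ∈ l, x i = y i) → g x = g y) :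
    ∃ t : DTree ι L, ∀ x, t.out x = g x ∧ t.cost x ≤ l.length := by
  induction l generalizing g with
  | nil => exact ⟨.leaf (g fun _ => false), fun x => ⟨hg _ _ (by simp), le_rfl⟩⟩
  | cons i l ih =>
    have key (b : Bool) := ih (fun x => g (Function.update x i b)) fun x y hxy =>
      hg _ _ fun j hj => by
      rcases eq_or_ne j i with rfl | hji
      · simp
      · simpa [hji] using hxy j ((List.mem_cons.1 hj).resolve_left hji)
    obtain ⟨t0, h0⟩ := key false
    obtain ⟨t1, h1⟩ := key true
    refine ⟨.node i t0 t1, fun x => ?_⟩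
    cases h : x i
    · have := h0 x
      rw [← h, Function.update_eq_self] at this
      simpa [out, cost, h] using this
    · have := h1 x
      rw [← h, Function.update_eq_self] at this
      simpa [out, cost, h] using this

theorem exists_out_eq [Fintype ι] [DecidableEq ι] (g : (ι → Bool) → L) :
    ∃ t : DTree ι L, ∀ x, t.out x = g x ∧ t.cost x ≤ Fintype.card ι := by
  obtain ⟨t, ht⟩ := exists_out_eq_of_list (univ : Finset ι).toList g fun x y h =>
    congrArg g (funext fun i => h i (by simp))
  exact ⟨t, by simpa using ht⟩

end DTree

section Profiles

variable {ι : Type}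

/-- The pairs of an acceptance probability and an expected cost, as functions of the input, that
are achieved by randomized algorithms. -/
def profiles (ι : Type) : Set (((ι → Bool) → ℝ) × ((ι → Bool) → ℝ)) :=
  convexHull ℝ (Set.range DTree.profile)

theorem convex_profiles : Convex ℝ (profiles ι) := convex_convexHull ℝ _

theorem profile_mem_profiles (t : DTree ι Bool) : t.profile ∈ profiles ι :=
  subset_convexHull ℝ _ ⟨t, rfl⟩

theorem const_mem_profiles (b : Bool) :
    ((fun _ => if b then 1 else 0, fun _ => 0) : ((ι → Bool) → ℝ) × ((ι → Bool) → ℝ)) ∈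
      profiles ι := by
  have := profile_mem_profiles (ι := ι) (.leaf b)
  cases b <;> simpa [DTree.profile, DTree.out, DTree.cost] using this

/-- Run `u`, then continue with `v0` or `v1` according to the answer. -/
def branch (u v0 v1 : ((ι → Bool) → ℝ) × ((ι → Bool) → ℝ)) :
    ((ι → Bool) → ℝ) × ((ι → Bool) → ℝ) :=
  (fun x => u.1 x * v1.1 x + (1 - u.1 x) * v0.1 x,
    fun x => u.2 x + (u.1 x * v1.2 x + (1 - u.1 x) * v0.2 x))

theorem branch_mem_profiles {u v0 v1 : ((ι → Bool) → ℝ) × ((ι → Bool) → ℝ)}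
    (hu : u ∈ profiles ι) (h0 : v0 ∈ profiles ι) (h1 : v1 ∈ profiles ι) :
    branch u v0 v1 ∈ profiles ι := by
  have c1 (u v0 : ((ι → Bool) → ℝ) × ((ι → Bool) → ℝ)) :
      Convex ℝ {v1 | branch u v0 v1 ∈ profiles ι} := by
    intro a ha b hb s t hs ht hst
    have : branch u v0 (s • a + t • b) = s • branch u v0 a + t • branch u v0 b := by
      obtain rfl := eq_sub_of_add_eq hst
      ext x <;> simp [branch] <;> ring
    rw [Set.mem_ofPred_eq, this]
    exact convex_profiles ha hb hs ht hst
  have c0 (u v1 : ((ι → Bool) → ℝ) × ((ι → Bool) → ℝ)) :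
      Convex ℝ {v0 | branch u v0 v1 ∈ profiles ι} := by
    intro a ha b hb s t hs ht hst
    have : branch u (s • a + t • b) v1 = s • branch u a v1 + t • branch u b v1 := by
      obtain rfl := eq_sub_of_add_eq hst
      ext x <;> simp [branch] <;> ring
    rw [Set.mem_ofPred_eq, this]
    exact convex_profiles ha hb hs ht hst
  have c (v0 v1 : ((ι → Bool) → ℝ) × ((ι → Bool) → ℝ)) :
      Convex ℝ {u | branch u v0 v1 ∈ profiles ι} := by
    intro a ha b hb s t hs ht hst
    have : branch (s • a + t • b) v0 v1 = s • branch a v0 v1 + t • branch b v0 v1 := by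
      obtain rfl := eq_sub_of_add_eq hst
      ext x <;> simp [branch] <;> ring
    rw [Set.mem_ofPred_eq, this]
    exact convex_profiles ha hb hs ht hst
  refine convexHull_min ?_ (c v0 v1) hu
  rintro _ ⟨t, rfl⟩
  refine convexHull_min ?_ (c0 _ v1) h0
  rintro _ ⟨t0, rfl⟩
  refine convexHull_min ?_ (c1 _ _) h1
  rintro _ ⟨t1, rfl⟩
  have : branch t.profile t0.profile t1.profile = (DTree.graft t0 t1 t).profile := by
    ext x <;> cases h : t.out x <;>
      simp [branch, DTree.profile, DTree.out_graft, DTree.cost_graft, h]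
  rw [Set.mem_ofPred_eq, this]
  exact profile_mem_profiles _

theorem profiles_bounds {v : ((ι → Bool) → ℝ) × ((ι → Bool) → ℝ)} (hv : v ∈ profiles ι)
    (x : ι → Bool) : 0 ≤ v.1 x ∧ v.1 x ≤ 1 ∧ 0 ≤ v.2 x := by
  have hc : Convex ℝ {v : ((ι → Bool) → ℝ) × ((ι → Bool) → ℝ) |
      0 ≤ v.1 x ∧ v.1 x ≤ 1 ∧ 0 ≤ v.2 x} := by
    rintro a ⟨ha, ha', ha''⟩ b ⟨hb, hb', hb''⟩ s t hs ht hst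
    simp only [Set.mem_ofPred_eq, Prod.fst_add, Prod.snd_add, Prod.smul_fst, Prod.smul_snd,
      Pi.add_apply, Pi.smul_apply, smul_eq_mul]
    refine ⟨by positivity, ?_, by positivity⟩
    linarith [mul_le_mul_of_nonneg_left ha' hs, mul_le_mul_of_nonneg_left hb' ht]
  refine convexHull_min ?_ hc hv
  rintro _ ⟨t, rfl⟩
  cases h : t.out x <;> simp [DTree.profile, h]

/-- The probability that the answer differs from `f x`. -/
def err (f : (ι → Bool) → Bool) (v : ((ι → Bool) → ℝ) × ((ι → Bool) → ℝ)) (x : ι → Bool) : ℝ :=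
  if f x then 1 - v.1 x else v.1 x

theorem err_nonneg (f : (ι → Bool) → Bool) {v : ((ι → Bool) → ℝ) × ((ι → Bool) → ℝ)}
    (hv : v ∈ profiles ι) (x : ι → Bool) : 0 ≤ err f v x := by
  obtain ⟨h0, h1, -⟩ := profiles_bounds hv x
  unfold err
  split_ifs <;> linarith

theorem err_le_one (f : (ι → Bool) → Bool) {v : ((ι → Bool) → ℝ) × ((ι → Bool) → ℝ)}
    (hv : v ∈ profiles ι) (x : ι → Bool) : err f v x ≤ 1 := by
  obtain ⟨h0, h1, -⟩ := profiles_bounds hv x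
  unfold err
  split_ifs <;> linarith

theorem err_combo (f : (ι → Bool) → Bool) (a b : ((ι → Bool) → ℝ) × ((ι → Bool) → ℝ)) {s t : ℝ}
    (hst : s + t = 1) (x : ι → Bool) :
    err f (s • a + t • b) x = s * err f a x + t * err f b x := by
  obtain rfl := eq_sub_of_add_eq hst
  unfold err
  split_ifs <;> simp <;> ring

/-- Two independent runs of `u` are answered if they agree; otherwise `z` takes over. -/
theorem exists_agree_or_restart (f : (ι → Bool) → Bool)
    {u z : ((ι → Bool) → ℝ) × ((ι → Bool) → ℝ)} (hu : u ∈ profiles ι) (hz : z ∈ profiles ι) :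
    ∃ v ∈ profiles ι, ∀ x,
      err f v x = err f u x ^ 2 + 2 * err f u x * (1 - err f u x) * err f z x ∧
      v.2 x = 2 * u.2 x + 2 * err f u x * (1 - err f u x) * z.2 x := by
  refine ⟨_, branch_mem_profiles hu (branch_mem_profiles hu (const_mem_profiles false) hz)
    (branch_mem_profiles hu hz (const_mem_profiles true)), fun x => ?_⟩
  constructor <;> cases h : f x <;> simp [err, branch, h] <;> ring

theorem convexOn_err (f : (ι → Bool) → Bool) (x : ι → Bool) :
    ConvexOn ℝ (profiles ι) fun v => err f v x :=
  ⟨convex_profiles, fun _ _ _ _ _ _ _ _ hst => (err_combo f _ _ hst x).le⟩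

theorem convexOn_snd (x : ι → Bool) : ConvexOn ℝ (profiles ι) fun v => v.2 x :=
  ⟨convex_profiles, fun _ _ _ _ _ _ _ _ _ => le_rfl⟩

theorem ConvexOn.sum_mul {E κ : Type*} [AddCommGroup E] [Module ℝ E] [Fintype κ] {P : Set E}
    (hP : Convex ℝ P) {φ : κ → E → ℝ} (hφ : ∀ i, ConvexOn ℝ P (φ i)) {w : κ → ℝ}
    (hw : ∀ i, 0 ≤ w i) : ConvexOn ℝ P fun v => ∑ i, w i * φ i v := by
  refine ⟨hP, fun a ha b hb s t hs ht hst => ?_⟩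
  simp only [smul_eq_mul, mul_sum, ← sum_add_distrib]
  refine sum_le_sum fun i _ => ?_
  have := mul_le_mul_of_nonneg_left ((hφ i).2 ha hb hs ht hst) (hw i)
  simp only [smul_eq_mul] at this
  linarith

/-- Iterating the rule that accepts the answer of two agreeing runs of `u` and otherwise restarts. -/
theorem exists_iterated_restart {X : Set (ι → Bool)} (f : (ι → Bool) → Bool) {l t : ℝ}
    (ht : 0 ≤ t) {u : ((ι → Bool) → ℝ) × ((ι → Bool) → ℝ)} (hu : u ∈ profiles ι)
    (h : ∀ x ∈ X, err f u x ^ 2 + 2 * l * u.2 x ≤ t * (1 - 2 * err f u x * (1 - err f u x)))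
    (k : ℕ) : ∃ z ∈ profiles ι, ∀ x ∈ X, err f z x + l * z.2 x ≤ t + (1 / 2) ^ k := by
  induction k with
  | zero =>
    refine ⟨_, const_mem_profiles false, fun x _ => ?_⟩
    have := err_le_one f (const_mem_profiles false) x
    simp only [mul_zero, add_zero, pow_zero] at this ⊢
    linarith
  | succ k ih =>
    obtain ⟨z, hz, hzx⟩ := ih
    obtain ⟨v, hv, hvx⟩ := exists_agree_or_restart f hu hz
    refine ⟨v, hv, fun x hx => ?_⟩
    obtain ⟨he, hc⟩ := hvx x
    have h0 := err_nonneg f hu x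
    have h1 := err_le_one f hu x
    set e := err f u x
    have hq : 0 ≤ 2 * e * (1 - e) := mul_nonneg (by positivity) (by linarith)
    have hq' : 2 * e * (1 - e) ≤ 1 / 2 := by linarith [sq_nonneg (1 - 2 * e)]
    have hk : (0 : ℝ) ≤ (1 / 2) ^ k := by positivity
    rw [he, hc, pow_succ (1 / 2 : ℝ) k]
    linarith [h x hx, mul_le_mul_of_nonneg_left (hzx x hx) hq,
      mul_le_mul_of_nonneg_right hq' hk]

end Profiles

section Distributional

variable {ι : Type} [Fintype ι] [DecidableEq ι]

theorem mass_inter_coord (μ : (ι → Bool) → ℝ) (i : ι) (b : Bool) (S : Set (ι → Bool)) :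
    mass μ ({y | y i = b} ∩ S) = mass (fun x => if x i = b then μ x else 0) S := by
  classical
  refine sum_congr rfl fun x _ => ?_
  by_cases hb : x i = b <;> by_cases hS : x ∈ S <;> simp [Set.indicator, hb, hS]

theorem sum_succLeafScore_node {L : Type} (f : (ι → Bool) → Bool) (μ : (ι → Bool) → ℝ) (i : ι)
    (t0 t1 : DTree ι L) :
    ∑ x, μ x * succLeafScore f μ (.node i t0 t1) x =
      ∑ x, (if x i = false then μ x else 0) *
        succLeafScore f (fun x => if x i = false then μ x else 0) t0 x +
      ∑ x, (if x i = true then μ x else 0) *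
        succLeafScore f (fun x => if x i = true then μ x else 0) t1 x := by
  rw [← sum_add_distrib]
  refine sum_congr rfl fun x _ => ?_
  cases h : x i <;>
    simp [succLeafScore, DTree.leafSet, h, Set.inter_assoc, mass_inter_coord]

theorem sum_succLeafScore_leaf {L : Type} (f : (ι → Bool) → Bool) {μ : (ι → Bool) → ℝ}
    (hμ : ∀ x, 0 ≤ μ x) (l : L) :
    ∑ x, μ x * succLeafScore f μ (.leaf l) x =
      max (∑ x, if false = f x then μ x else 0) (∑ x, if true = f x then μ x else 0) := by
  classical
  have h (b : Bool) : mass μ {y | f y = b} = ∑ x, if b = f x then μ x else 0 :=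
    sum_congr rfl fun x _ => by simp [Set.indicator, eq_comm]
  have hu : mass μ Set.univ = ∑ x, μ x := by simp [mass]
  simp only [succLeafScore, DTree.leafSet, Set.univ_inter, h, hu, ← sum_mul]
  rcases eq_or_ne (∑ x, μ x) 0 with h0 | h0
  · have := (sum_eq_zero_iff_of_nonneg fun x _ => hμ x).1 h0
    simp [fun x => this x (mem_univ x)]
  · rw [mul_div_cancel₀ _ h0]

theorem sum_out_eq_node (f : (ι → Bool) → Bool) (μ : (ι → Bool) → ℝ) (i : ι)
    (t0 t1 : DTree ι Bool) :
    (∑ x, if (DTree.node i t0 t1).out x = f x then μ x else 0) =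
      (∑ x, if t0.out x = f x then (if x i = false then μ x else 0) else 0) +
      ∑ x, if t1.out x = f x then (if x i = true then μ x else 0) else 0 := by
  rw [← sum_add_distrib]
  refine sum_congr rfl fun x _ => ?_
  cases h : x i <;> simp [DTree.out, h]

theorem DTree.exists_labelling (f : (ι → Bool) → Bool) (t : DTree ι Unit) {μ : (ι → Bool) → ℝ}
    (hμ : ∀ x, 0 ≤ μ x) :
    ∃ t' : DTree ι Bool, (∀ x, t'.cost x = t.cost x) ∧
      (∑ x, if t'.out x = f x then μ x else 0) = ∑ x, μ x * succLeafScore f μ t x := by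
  induction t generalizing μ with
  | leaf l =>
    rw [sum_succLeafScore_leaf f hμ]
    rcases max_choice (∑ x, if false = f x then μ x else 0)
      (∑ x, if true = f x then μ x else 0) with h | h
    · exact ⟨.leaf false, fun x => rfl, h.symm⟩
    · exact ⟨.leaf true, fun x => rfl, h.symm⟩
  | node i t0 t1 ih0 ih1 =>
    obtain ⟨t0', hc0, hs0⟩ := @ih0 (fun x => if x i = false then μ x else 0)
      fun x => by split_ifs <;> simp [hμ]
    obtain ⟨t1', hc1, hs1⟩ := @ih1 (fun x => if x i = true then μ x else 0)
      fun x => by split_ifs <;> simp [hμ]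
    refine ⟨.node i t0' t1', fun x => by simp [cost, hc0, hc1], ?_⟩
    rw [sum_out_eq_node, sum_succLeafScore_node, hs0, hs1]

/-- Forget the leaf labels. -/
def DTree.erase {ι L : Type} : DTree ι L → DTree ι Unit
  | .leaf _ => .leaf ()
  | .node i t0 t1 => .node i t0.erase t1.erase

theorem DTree.cost_erase {ι L : Type} (t : DTree ι L) (x : ι → Bool) :
    t.erase.cost x = t.cost x := by
  induction t with
  | leaf l => rfl
  | node i t0 t1 h0 h1 => simp [erase, cost, h0, h1]

theorem DTree.sum_out_eq_le (f : (ι → Bool) → Bool) (t : DTree ι Bool) {μ : (ι → Bool) → ℝ}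
    (hμ : ∀ x, 0 ≤ μ x) :
    (∑ x, if t.out x = f x then μ x else 0) ≤ ∑ x, μ x * succLeafScore f μ t.erase x := by
  induction t generalizing μ with
  | leaf b =>
    rw [erase, sum_succLeafScore_leaf f hμ]
    cases b
    · exact le_max_left _ _
    · exact le_max_right _ _
  | node i t0 t1 ih0 ih1 =>
    rw [sum_out_eq_node, erase, sum_succLeafScore_node]
    exact add_le_add (ih0 fun x => by split_ifs <;> simp [hμ])
      (ih1 fun x => by split_ifs <;> simp [hμ])

theorem sum_out_eq_profile (f : (ι → Bool) → Bool) (μ : (ι → Bool) → ℝ) (t : DTree ι Bool) :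
    (∑ x, if t.out x = f x then μ x else 0) = ∑ x, μ x * (1 - err f t.profile x) := by
  refine sum_congr rfl fun x _ => ?_
  cases h : t.out x <;> cases h' : f x <;> simp [err, DTree.profile, h, h']

theorem one_sub_sum_err_sum_smul {κ : Type*} [Fintype κ] {w : κ → ℝ} (hw : ∑ i, w i = 1)
    (z : κ → ((ι → Bool) → ℝ) × ((ι → Bool) → ℝ)) (f : (ι → Bool) → Bool) {μ : (ι → Bool) → ℝ}
    (hμ : ∑ x, μ x = 1) :
    1 - ∑ x, μ x * err f (∑ i, w i • z i) x = ∑ i, w i * ∑ x, μ x * (1 - err f (z i) x) := by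
  have h (x : ι → Bool) : err f (∑ i, w i • z i) x = ∑ i, w i * err f (z i) x := by
    unfold err
    split_ifs <;> simp [mul_sub, hw, Prod.fst_sum]
  have h' (i : κ) : w i * ∑ x, μ x * (1 - err f (z i) x) =
      w i - ∑ x, μ x * (w i * err f (z i) x) := by
    simp only [mul_sub, mul_one, sum_sub_distrib, hμ, mul_sum, mul_left_comm]
  simp only [h, h', sum_sub_distrib, hw, mul_sum]
  rw [sum_comm]

theorem sum_mul_snd_sum_smul {κ : Type*} [Fintype κ] (w : κ → ℝ)
    (z : κ → ((ι → Bool) → ℝ) × ((ι → Bool) → ℝ)) (μ : (ι → Bool) → ℝ) :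
    ∑ x, μ x * (∑ i, w i • z i).2 x = ∑ i, w i * ∑ x, μ x * (z i).2 x := by
  simp only [Prod.snd_sum, Finset.sum_apply, Prod.smul_snd, Pi.smul_apply, smul_eq_mul, mul_sum]
  rw [sum_comm]
  exact sum_congr rfl fun i _ => sum_congr rfl fun x _ => by ring

theorem exists_randAlg {X : Set (ι → Bool)} (f : (ι → Bool) → Bool) (μ : InputDist ι X)
    {v : ((ι → Bool) → ℝ) × ((ι → Bool) → ℝ)} (hv : v ∈ profiles ι) :
    ∃ R : RandAlg ι Unit, 1 - ∑ x, μ.μ x * err f v x ≤ succAlgScore f μ.μ R ∧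
      expCost μ.μ R = ∑ x, μ.μ x * v.2 x := by
  obtain ⟨κ, _, w, z, hw0, hw1, hz, rfl⟩ := mem_convexHull_iff_exists_fintype.1 hv
  choose T hT using hz
  let e := Fintype.equivFin κ
  refine ⟨⟨Fintype.card κ, fun j => w (e.symm j), fun j => (T (e.symm j)).erase,
    fun j => hw0 _, by rw [e.symm.sum_comp w, hw1]⟩, ?_, ?_⟩
  · rw [one_sub_sum_err_sum_smul hw1 z f μ.sum_one, ← e.symm.sum_comp]
    refine sum_le_sum fun j _ => mul_le_mul_of_nonneg_left ?_ (hw0 _)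
    rw [← hT, ← sum_out_eq_profile]
    exact DTree.sum_out_eq_le f _ μ.nonneg
  · simp only [sum_mul_snd_sum_smul, expCost, DTree.cost_erase, ← hT, DTree.profile]
    exact e.symm.sum_comp fun i => w i * ∑ x, μ.μ x * ((T i).cost x : ℝ)

theorem expCost_nonneg {L : Type} {X : Set (ι → Bool)} (μ : InputDist ι X) (R : RandAlg ι L) :
    0 ≤ expCost μ.μ R :=
  sum_nonneg fun j _ => mul_nonneg (R.p_nonneg j)
    (sum_nonneg fun x _ => mul_nonneg (μ.nonneg x) (Nat.cast_nonneg _))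

theorem succRdist_le {X : Set (ι → Bool)} (f : (ι → Bool) → Bool) (μ : InputDist ι X) {γ : ℝ}
    {v : ((ι → Bool) → ℝ) × ((ι → Bool) → ℝ)} (hv : v ∈ profiles ι)
    (h : ∑ x, μ.μ x * err f v x ≤ 1 - γ) : succRdist f μ.μ γ ≤ ∑ x, μ.μ x * v.2 x := by
  obtain ⟨R, hR, hR'⟩ := exists_randAlg f μ hv
  refine csInf_le ⟨0, ?_⟩ ⟨R, by linarith, hR'⟩
  rintro _ ⟨R, -, rfl⟩
  exact expCost_nonneg μ R

theorem exists_exact_profile (f : (ι → Bool) → Bool) :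
    ∃ v ∈ profiles ι, ∀ x, err f v x = 0 ∧ v.2 x ≤ Fintype.card ι := by
  obtain ⟨t, ht⟩ := DTree.exists_out_eq f
  refine ⟨t.profile, profile_mem_profiles t, fun x => ⟨?_, Nat.cast_le.2 (ht x).2⟩⟩
  cases h : f x <;> simp [err, DTree.profile, h, (ht x).1]

theorem exists_profile_lt {X : Set (ι → Bool)} (f : (ι → Bool) → Bool) (μ : InputDist ι X)
    {γ c : ℝ} (hγ : γ ≤ 1) (hc : succRdist f μ.μ γ < c) :
    ∃ v ∈ profiles ι, ∑ x, μ.μ x * err f v x ≤ 1 - γ ∧ ∑ x, μ.μ x * v.2 x < c := by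
  have hne : {c | ∃ R : RandAlg ι Unit, γ ≤ succAlgScore f μ.μ R ∧ expCost μ.μ R = c}.Nonempty := by
    obtain ⟨v, hv, hv'⟩ := exists_exact_profile f
    obtain ⟨R, hR, -⟩ := exists_randAlg f μ hv
    exact ⟨_, R, hγ.trans (by simpa [fun x => (hv' x).1] using hR), rfl⟩
  obtain ⟨_, ⟨R, hR, rfl⟩, hlt⟩ := exists_lt_of_csInf_lt hne hc
  choose T hTc hTs using fun j => (R.T j).exists_labelling f μ.nonneg
  refine ⟨∑ j, R.p j • (T j).profile, convex_profiles.sum_mem (fun j _ => R.p_nonneg j) R.p_sum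
    fun j _ => profile_mem_profiles _, ?_, ?_⟩
  · have h := one_sub_sum_err_sum_smul R.p_sum (fun j => (T j).profile) f μ.sum_one
    simp only [← sum_out_eq_profile, hTs] at h
    change _ = succAlgScore f μ.μ R at h
    linarith
  · rw [sum_mul_snd_sum_smul]
    simpa only [expCost, DTree.profile, hTc] using hlt

end Distributional

section Amplification

variable {ι : Type} [Fintype ι] [DecidableEq ι]

/-- If on every distribution some algorithm has error at most `ε` and cost below `C`, then a single
algorithm has, on all inputs, the corresponding bound on every positive combination of error and
cost. -/
theorem exists_profile_forall_lt {X : Set (ι → Bool)} [Nonempty X] (f : (ι → Bool) → Bool)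
    {ε C a : ℝ} (ha : 0 < a)
    (H : ∀ μ : InputDist ι X,
      ∃ v ∈ profiles ι, ∑ x, μ.μ x * err f v x ≤ ε ∧ ∑ x, μ.μ x * v.2 x < C) :
    ∃ v ∈ profiles ι, ∀ x ∈ X, err f v x + a * v.2 x < ε + a * C := by
  classical
  suffices h : ∃ v ∈ profiles ι, ∀ x : X, err f v x + a * v.2 x < ε + a * C by
    obtain ⟨v, hv, h⟩ := h
    exact ⟨v, hv, fun x hx => h ⟨x, hx⟩⟩
  refine exists_forall_lt_of_forall_weights (φ := fun (x : X) v => err f v x + a * v.2 x)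
    (b := fun _ => ε + a * C)
    (fun x => (convexOn_err f x).add ((convexOn_snd _).smul ha.le)) fun w hw0 hw1 => ?_
  let ν : (ι → Bool) → ℝ := fun x => if h : x ∈ X then w ⟨x, h⟩ else 0
  have hν (F : (ι → Bool) → ℝ) : ∑ x : X, w x * F x = ∑ x, ν x * F x :=
    Fintype.sum_of_injective Subtype.val Subtype.val_injective _ _
      (fun x hx => by simp [ν, show x ∉ X by simpa using hx]) fun x => by simp [ν]
  obtain ⟨v, hv, h1, h2⟩ := H
    { μ := ν
      nonneg := fun x => by
        dsimp only [ν]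
        split_ifs
        exacts [hw0 _, le_rfl]
      sum_one := by simpa [hw1] using (hν fun _ => 1).symm
      supp := fun x hx => dif_neg hx }
  refine ⟨v, hv, ?_⟩
  rw [← sum_mul, hw1, hν fun x => err f v x + a * v.2 x]
  simp only [mul_add, sum_add_distrib, mul_left_comm _ a, ← mul_sum]
  linarith [mul_lt_mul_of_pos_left h2 ha]

theorem exists_amplified_profile {X : Set (ι → Bool)} (f : (ι → Bool) → Bool) {ε g C η : ℝ}
    (hg : 0 < g) (h3 : 3 * g ≤ ε) (h4 : 3 * g ≤ 1 - 2 * ε) (hC : 0 < C) (hη : 0 < η)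
    (H : ∀ μ : InputDist ι X,
      ∃ v ∈ profiles ι, ∑ x, μ.μ x * err f v x ≤ ε ∧ ∑ x, μ.μ x * v.2 x < C)
    (μ : InputDist ι X) :
    ∃ v ∈ profiles ι, ∑ x, μ.μ x * err f v x < ε - g ∧ ∑ x, μ.μ x * v.2 x < 4 * C + η := by
  have key := exists_forall_lt_of_forall_weights (P := profiles ι)
    (φ := ![fun v => ∑ x, μ.μ x * err f v x, fun v => ∑ x, μ.μ x * v.2 x])
    (b := ![ε - g, 4 * C + η])
    (Fin.forall_fin_two.2 ⟨ConvexOn.sum_mul convex_profiles (convexOn_err f) μ.nonneg,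
      ConvexOn.sum_mul convex_profiles convexOn_snd μ.nonneg⟩) fun w hw0 hw1 => ?_
  · obtain ⟨v, hv, h⟩ := key
    exact ⟨v, hv, h 0, h 1⟩
  simp only [Fin.sum_univ_two, Matrix.cons_val_zero, Matrix.cons_val_one] at hw1 ⊢
  have hw0' := hw0 0
  have hw1' := hw0 1
  generalize w 0 = a at *
  generalize w 1 = b at *
  rcases hw1'.eq_or_lt with rfl | hb
  · obtain ⟨v, hv, hvx⟩ := exists_exact_profile f
    refine ⟨v, hv, ?_⟩
    simp only [fun x => (hvx x).1, mul_zero, sum_const_zero, zero_mul, add_zero] at hw1 ⊢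
    exact mul_pos (by linarith) (by linarith)
  rcases le_or_gt (a * g) (3 * (b * C)) with hab | hab
  · obtain ⟨v, hv, he, hc⟩ := H μ
    refine ⟨v, hv, ?_⟩
    linarith [mul_le_mul_of_nonneg_left he hw0', mul_lt_mul_of_pos_left hc hb, mul_pos hb hη]
  have ha : 0 < a := by
    refine hw0'.lt_of_ne ?_
    rintro rfl
    have : 0 < b * C := by positivity
    linarith
  have hX : Nonempty X := by
    by_contra hX
    have := μ.sum_one
    rw [sum_eq_zero fun x _ => μ.supp x fun hx => hX ⟨x, hx⟩] at this
    exact zero_ne_one this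
  obtain ⟨l, hl⟩ : ∃ l, l = b / a := ⟨_, rfl⟩
  have hl0 : 0 < l := hl ▸ div_pos hb ha
  have hal : a * l = b := by rw [hl, mul_div_cancel₀ _ ha.ne']
  have hlC : 0 < l * C := by positivity
  have hL : 3 * (l * C) ≤ g := by
    refine le_of_mul_le_mul_left ?_ ha
    rw [← hal] at hab
    linarith
  have hs : 0 < ε - g + 2 * (l * C) := by linarith
  have hε : 0 < ε := by linarith
  obtain ⟨u, hu, hux⟩ := exists_profile_forall_lt f
    (show 0 < 2 * ε * l / (ε - g + 2 * (l * C)) by positivity) H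
  obtain ⟨k, hk⟩ := exists_pow_lt_of_lt_one (show 0 < l * η by positivity)
    (show (1 / 2 : ℝ) < 1 by norm_num)
  obtain ⟨v, hv, hvx⟩ := exists_iterated_restart f
    (show 0 ≤ ε - g + 4 * (l * C) by linarith) hu
    (fun x hx => race_step hg h3 h4 hl0 hC.le hL (err_nonneg f hu x)
      (profiles_bounds hu x).2.2 (hux x hx).le) k
  refine ⟨v, hv, ?_⟩
  have hsum : ∑ x, μ.μ x * (err f v x + l * v.2 x) ≤
      ∑ x, μ.μ x * (ε - g + 4 * (l * C) + (1 / 2) ^ k) := by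
    refine sum_le_sum fun x _ => ?_
    by_cases hx : x ∈ X
    · exact mul_le_mul_of_nonneg_left (hvx x hx) (μ.nonneg x)
    · simp [μ.supp x hx]
  rw [← sum_mul, μ.sum_one] at hsum
  simp only [mul_add, sum_add_distrib, mul_left_comm _ l, ← mul_sum] at hsum
  rw [← hal]
  have := mul_le_mul_of_nonneg_left hsum ha.le
  linarith [mul_lt_mul_of_pos_left hk ha]

theorem succRdist_nonneg {X : Set (ι → Bool)} (f : (ι → Bool) → Bool) (μ : InputDist ι X) (γ : ℝ) :
    0 ≤ succRdist f μ.μ γ := by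
  refine Real.sInf_nonneg ?_
  rintro _ ⟨R, -, rfl⟩
  exact expCost_nonneg μ R

theorem succRdist_le_card {X : Set (ι → Bool)} (f : (ι → Bool) → Bool) (μ : InputDist ι X) {γ : ℝ}
    (hγ : γ ≤ 1) : succRdist f μ.μ γ ≤ Fintype.card ι := by
  obtain ⟨v, hv, hvx⟩ := exists_exact_profile f
  refine (succRdist_le f μ hv (by simpa [fun x => (hvx x).1] using hγ)).trans ?_
  refine (sum_le_sum fun x _ => mul_le_mul_of_nonneg_left (hvx x).2 (μ.nonneg x)).trans_eq ?_
  rw [← sum_mul, μ.sum_one, one_mul]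

end Amplification

/-- **Success amplification for maximum distributional complexity**:
`R̄̄_{γ+δ/3}(f) ≤ 4·R̄̄_γ(f)` whenever `(1+δ)/2 ≤ γ ≤ 1−δ` (success-probability score). -/
theorem success_amplification_maximum_distributional
    (m : ℕ) (X : Set (Fin m → Bool)) (f : (Fin m → Bool) → Bool)
    (δ : ℝ) (hδ : 0 < δ) (γ : ℝ) (h1 : (1 + δ) / 2 ≤ γ) (h2 : γ ≤ 1 - δ) :
    succRmax X f (γ + δ / 3) ≤ 4 * succRmax X f γ := by
  rcases isEmpty_or_nonempty (InputDist (Fin m) X) with hE | hE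
  · simp [succRmax, Real.iSup_of_isEmpty]
  have hbdd : BddAbove (Set.range fun μ : InputDist (Fin m) X => succRdist f μ.μ γ) := by
    refine ⟨Fintype.card (Fin m), ?_⟩
    rintro _ ⟨μ, rfl⟩
    exact succRdist_le_card f μ (by linarith)
  have hle (μ : InputDist (Fin m) X) : succRdist f μ.μ γ ≤ succRmax X f γ := le_ciSup hbdd μ
  have h0 : 0 ≤ succRmax X f γ := Real.iSup_nonneg fun μ => succRdist_nonneg f μ γ
  refine ciSup_le fun μ => le_of_forall_pos_lt_add fun η hη => ?_
  obtain ⟨v, hv, he, hc⟩ := exists_amplified_profile f (ε := 1 - γ) (g := δ / 3)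
    (C := succRmax X f γ + η / 5) (η := η / 5) (by linarith) (by linarith) (by linarith)
    (by linarith) (by linarith)
    (fun ν => exists_profile_lt f ν (by linarith) (by linarith [hle ν])) μ
  have := succRdist_le f μ (γ := γ + δ / 3) hv (by linarith)
  linarith
end

section
/- Linear amplification for Hellinger score: there is a universal constant C such that for every δ ∈ (0, 1] and every (possibly partial) function f : X → {0,1} with X ⊆ {0,1}^m, the bounded-error worst-case randomized query complexity satisfies R(f) ≤ (C/δ)·R̄̄_{Hel, (1+δ)/2}(f), where R(f) = R_{2/3}(f). -/
open Finset

section Weights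

variable {ι L : Type}

namespace DTree

/-- The tree cut off at depth `n`, with `default` as label of the new leaves. -/
def truncate [Inhabited L] : ℕ → DTree ι L → DTree ι L
  | _, .leaf lab => .leaf lab
  | 0, .node _ _ _ => .leaf default
  | n + 1, .node i t0 t1 => .node i (truncate n t0) (truncate n t1)

theorem depth_truncate_le [Inhabited L] (t : DTree ι L) (n : ℕ) : (truncate n t).depth ≤ n := by
  induction t generalizing n with
  | leaf lab => cases n <;> simp [truncate, depth]
  | node i t0 t1 h0 h1 =>
    cases n with
    | zero => simp [truncate, depth]
    | succ n => simpa [truncate, depth] using ⟨h0 n, h1 n⟩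

theorem out_truncate [Inhabited L] (n : ℕ) (t : DTree ι L) (x : ι → Bool) (h : t.cost x ≤ n) :
    (truncate n t).out x = t.out x := by
  induction t generalizing n with
  | leaf lab => cases n <;> simp [truncate]
  | node i t0 t1 h0 h1 =>
    cases n with
    | zero => simp [cost] at h
    | succ n =>
      simp only [cost, add_le_add_iff_right] at h
      simp only [truncate, out]
      split_ifs at h ⊢
      · exact h1 n h
      · exact h0 n h

/-- The tree querying all coordinates in a list. -/
def queryAll : List ι → DTree ι Unit
  | [] => .leaf ()
  | i :: l => .node i (queryAll l) (queryAll l)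

theorem cost_queryAll (l : List ι) (x : ι → Bool) : (queryAll l).cost x = l.length := by
  induction l with
  | nil => rfl
  | cons i l ih => simp [queryAll, cost, ih]

theorem leafSet_queryAll (l : List ι) (x : ι → Bool) :
    (queryAll l).leafSet x = {y | ∀ i ∈ l, y i = x i} := by
  induction l with
  | nil => simp [queryAll, leafSet]
  | cons i l ih => ext y; simp [queryAll, leafSet, ih]

theorem allLabels_true (t : DTree ι L) : t.allLabels fun _ => True := by
  induction t with
  | leaf lab => trivial
  | node i t0 t1 h0 h1 => exact ⟨h0, h1⟩

end DTree

/-- The restriction of a weight function to the inputs with `x i = b`. -/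
noncomputable def restrictBit (i : ι) (b : Bool) (w : (ι → Bool) → ℝ) : (ι → Bool) → ℝ :=
  Set.indicator {x | x i = b} w

theorem restrictBit_nonneg {i : ι} {b : Bool} {w : (ι → Bool) → ℝ} (hw : 0 ≤ w) :
    0 ≤ restrictBit i b w := fun x => Set.indicator_nonneg (fun y _ => hw y) x

theorem indicator_restrictBit (S : Set (ι → Bool)) (i : ι) (b : Bool) (w : (ι → Bool) → ℝ) :
    S.indicator (restrictBit i b w) = (S ∩ {x | x i = b}).indicator w := by
  rw [restrictBit, Set.indicator_indicator]

theorem restrictBit_add (i : ι) (w : (ι → Bool) → ℝ) (x : ι → Bool) :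
    restrictBit i false w x + restrictBit i true w x = w x := by
  cases h : x i <;> simp [restrictBit, Set.indicator, h]

variable [Fintype ι] [DecidableEq ι]

/-- The weight of the inputs with `f x = b`. -/
def sideMass (f : (ι → Bool) → Bool) (w : (ι → Bool) → ℝ) (b : Bool) : ℝ :=
  ∑ x, if f x = b then w x else 0

/-- Twice the geometric mean of the weights of the two sides of `f`. -/
noncomputable def affinity (f : (ι → Bool) → Bool) (w : (ι → Bool) → ℝ) : ℝ :=
  2 * Real.sqrt (sideMass f w true * sideMass f w false)

/-- The sum over the leaves of the affinity of the weights reaching them. -/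
noncomputable def leafAffinity (f : (ι → Bool) → Bool) : DTree ι L → ((ι → Bool) → ℝ) → ℝ
  | .leaf _, w => affinity f w
  | .node i t0 t1, w =>
    leafAffinity f t0 (restrictBit i false w) + leafAffinity f t1 (restrictBit i true w)

/-- Total cost of a tree under a weight function. -/
def weightedCost (w : (ι → Bool) → ℝ) (t : DTree ι L) : ℝ := ∑ x, w x * (t.cost x : ℝ)

/-- Total weight of the inputs on which a tree errs. -/
def weightedError (f : (ι → Bool) → Bool) (w : (ι → Bool) → ℝ) (t : DTree ι Bool) : ℝ :=
  ∑ x, if t.out x = f x then 0 else w x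

theorem sideMass_nonneg {f : (ι → Bool) → Bool} {w : (ι → Bool) → ℝ} (hw : 0 ≤ w) (b : Bool) :
    0 ≤ sideMass f w b :=
  sum_nonneg fun x _ => by split_ifs; exacts [hw x, le_rfl]

theorem sideMass_add (f : (ι → Bool) → Bool) (w : (ι → Bool) → ℝ) :
    sideMass f w true + sideMass f w false = ∑ x, w x := by
  rw [sideMass, sideMass, ← sum_add_distrib]
  refine sum_congr rfl fun x _ => ?_
  cases f x <;> simp

theorem affinity_nonneg (f : (ι → Bool) → Bool) (w : (ι → Bool) → ℝ) : 0 ≤ affinity f w := by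
  unfold affinity; positivity

theorem leafAffinity_nonneg (f : (ι → Bool) → Bool) (t : DTree ι L) (w : (ι → Bool) → ℝ) :
    0 ≤ leafAffinity f t w := by
  induction t generalizing w with
  | leaf lab => exact affinity_nonneg f w
  | node i t0 t1 h0 h1 => exact add_nonneg (h0 _) (h1 _)

theorem affinity_le {f : (ι → Bool) → Bool} {w : (ι → Bool) → ℝ} (hw : 0 ≤ w) :
    affinity f w ≤ ∑ x, w x := by
  rw [← sideMass_add f w, affinity, Real.sqrt_mul (sideMass_nonneg hw _)]
  have h1 := Real.sq_sqrt (sideMass_nonneg (f := f) hw true)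
  have h0 := Real.sq_sqrt (sideMass_nonneg (f := f) hw false)
  nlinarith [sq_nonneg (√(sideMass f w true) - √(sideMass f w false))]

theorem two_mul_min_le_affinity {f : (ι → Bool) → Bool} {w : (ι → Bool) → ℝ} (hw : 0 ≤ w) :
    2 * min (sideMass f w true) (sideMass f w false) ≤ affinity f w := by
  have h1 := sideMass_nonneg (f := f) hw true
  have h0 := sideMass_nonneg (f := f) hw false
  refine mul_le_mul_of_nonneg_left (Real.le_sqrt_of_sq_le ?_) zero_le_two
  rw [sq]
  exact mul_le_mul (min_le_left _ _) (min_le_right _ _) (le_min h1 h0) h1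

theorem sum_restrictBit (i : ι) (w g0 g1 : (ι → Bool) → ℝ) :
    ∑ x, w x * (if x i then g1 x else g0 x) =
      ∑ x, restrictBit i false w x * g0 x + ∑ x, restrictBit i true w x * g1 x := by
  rw [← sum_add_distrib]
  refine sum_congr rfl fun x _ => ?_
  cases h : x i <;> simp [restrictBit, Set.indicator, h]

theorem sum_restrictBit_add (i : ι) (w : (ι → Bool) → ℝ) :
    ∑ x, restrictBit i false w x + ∑ x, restrictBit i true w x = ∑ x, w x := by
  rw [← sum_add_distrib]
  exact sum_congr rfl fun x _ => restrictBit_add i w x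

theorem weightedCost_node (w : (ι → Bool) → ℝ) (i : ι) (t0 t1 : DTree ι L) :
    weightedCost w (.node i t0 t1) =
      weightedCost (restrictBit i false w) t0 + weightedCost (restrictBit i true w) t1 +
        ∑ x, w x := by
  rw [weightedCost, weightedCost, weightedCost, ← sum_restrictBit, ← sum_add_distrib]
  refine sum_congr rfl fun x _ => ?_
  simp only [DTree.cost]
  split_ifs <;> push_cast <;> ring

theorem weightedError_node (f : (ι → Bool) → Bool) (w : (ι → Bool) → ℝ) (i : ι)
    (t0 t1 : DTree ι Bool) :
    weightedError f w (.node i t0 t1) =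
      weightedError f (restrictBit i false w) t0 + weightedError f (restrictBit i true w) t1 := by
  rw [weightedError, weightedError, weightedError, ← sum_add_distrib]
  refine sum_congr rfl fun x _ => ?_
  cases h : x i <;> simp [restrictBit, Set.indicator, h, DTree.out]

theorem mass_inter_bit (w : (ι → Bool) → ℝ) (i : ι) (b : Bool) (S : Set (ι → Bool)) :
    mass w ({y | y i = b} ∩ S) = mass (restrictBit i b w) S := by
  simp only [mass, indicator_restrictBit, Set.inter_comm]

theorem leafBias_node (f : (ι → Bool) → Bool) (w : (ι → Bool) → ℝ) (i : ι)
    (t0 t1 : DTree ι L) (x : ι → Bool) :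
    leafBias f w (.node i t0 t1) x =
      if x i then leafBias f (restrictBit i true w) t1 x
      else leafBias f (restrictBit i false w) t0 x := by
  cases h : x i <;> simp [leafBias, DTree.leafSet, h, Set.inter_assoc, mass_inter_bit]

theorem sum_sqrt_leafBias (f : (ι → Bool) → Bool) (t : DTree ι L) {w : (ι → Bool) → ℝ}
    (hw : 0 ≤ w) :
    ∑ x, w x * Real.sqrt (leafBias f w t x * (1 - leafBias f w t x)) =
      leafAffinity f t w / 2 := by
  induction t generalizing w with
  | leaf lab =>
    have hb : ∀ x, leafBias f w (.leaf lab : DTree ι L) x =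
        sideMass f w true / (sideMass f w true + sideMass f w false) := by
      intro x
      rw [sideMass_add]
      simp only [leafBias, DTree.leafSet, mass, sideMass, Set.univ_inter, Set.indicator_univ]
      congr! 2 with y
      by_cases h : f y = true <;> simp [Set.indicator, h]
    simp only [hb, ← sum_mul, leafAffinity, affinity, ← sideMass_add f w]
    have h1 := sideMass_nonneg (f := f) hw true
    have h0 := sideMass_nonneg (f := f) hw false
    set a := sideMass f w true
    set b := sideMass f w false
    rcases (add_nonneg h1 h0).eq_or_lt with h | h
    · have ha : a = 0 := by linarith
      simp [ha]
    · have : a / (a + b) * (1 - a / (a + b)) = a * b / (a + b) ^ 2 := by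
        field_simp; ring
      rw [this, Real.sqrt_div (mul_nonneg h1 h0), Real.sqrt_sq h.le]
      field_simp
  | node i t0 t1 h0 h1 =>
    rw [leafAffinity, add_div, ← h0 (restrictBit_nonneg hw), ← h1 (restrictBit_nonneg hw),
      ← sum_restrictBit]
    refine sum_congr rfl fun x _ => ?_
    rw [leafBias_node]
    split_ifs <;> rfl

theorem helScoreAlg_eq (f : (ι → Bool) → Bool) {w : (ι → Bool) → ℝ} (hw : 0 ≤ w)
    (hs : ∑ x, w x = 1) (R : RandAlg ι L) :
    helScoreAlg f w R = 1 - (∑ j, R.p j * leafAffinity f (R.T j) w) / 2 := by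
  have : ∀ j, R.p j * ∑ x, w x *
      (1 - Real.sqrt (leafBias f w (R.T j) x * (1 - leafBias f w (R.T j) x))) =
      R.p j - R.p j * leafAffinity f (R.T j) w / 2 := by
    intro j
    rw [mul_div_assoc, ← sum_sqrt_leafBias f (R.T j) hw, ← mul_one_sub, ← hs, ← sum_sub_distrib]
    simp only [mul_one_sub, hs]
  rw [helScoreAlg, sum_congr rfl fun j _ => this j, sum_sub_distrib, R.p_sum, sum_div]

theorem affinity_scale (f : (ι → Bool) → Bool) (c : Bool → ℝ) (hc : ∀ b, 0 ≤ c b)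
    (w : (ι → Bool) → ℝ) :
    affinity f (fun x => c (f x) * w x) = Real.sqrt (c true * c false) * affinity f w := by
  have h : ∀ b, sideMass f (fun x => c (f x) * w x) b = c b * sideMass f w b := by
    intro b
    rw [sideMass, sideMass, mul_sum]
    refine sum_congr rfl fun x _ => ?_
    split_ifs with h <;> simp [h]
  rw [affinity, affinity, h, h, mul_mul_mul_comm, Real.sqrt_mul (mul_nonneg (hc _) (hc _))]
  ring

theorem leafAffinity_scale (f : (ι → Bool) → Bool) (c : Bool → ℝ) (hc : ∀ b, 0 ≤ c b)
    (t : DTree ι L) (w : (ι → Bool) → ℝ) :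
    leafAffinity f t (fun x => c (f x) * w x) =
      Real.sqrt (c true * c false) * leafAffinity f t w := by
  induction t generalizing w with
  | leaf lab => exact affinity_scale f c hc w
  | node i t0 t1 h0 h1 =>
    have h : ∀ b, restrictBit i b (fun x => c (f x) * w x) =
        fun x => c (f x) * restrictBit i b w x := by
      intro b; ext x; simp [restrictBit, Set.indicator]
    rw [leafAffinity, leafAffinity, h, h, h0, h1, mul_add]

theorem exists_graft {f : (ι → Bool) → Bool} {κ c : ℝ} (t : DTree ι L) (w : (ι → Bool) → ℝ)
    (h : ∀ S : Set (ι → Bool), affinity f (S.indicator w) ≤ leafAffinity f t w →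
      ∃ T : DTree ι Bool, κ * weightedCost (S.indicator w) T ≤ affinity f (S.indicator w) ∧
        weightedError f (S.indicator w) T ≤ c * ∑ x, S.indicator w x) :
    ∃ T : DTree ι Bool, κ * weightedCost w T ≤ leafAffinity f t w + κ * weightedCost w t ∧
      weightedError f w T ≤ c * ∑ x, w x := by
  induction t generalizing w with
  | leaf lab =>
    simpa [weightedCost, DTree.cost, leafAffinity] using h Set.univ (by simp [leafAffinity])
  | node i t0 t1 h0 h1 =>
    obtain ⟨T0, c0, e0⟩ := h0 (restrictBit i false w) fun S hS => by
      rw [indicator_restrictBit] at hS ⊢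
      exact h _ (hS.trans (le_add_of_nonneg_right (leafAffinity_nonneg f t1 _)))
    obtain ⟨T1, c1, e1⟩ := h1 (restrictBit i true w) fun S hS => by
      rw [indicator_restrictBit] at hS ⊢
      exact h _ (hS.trans (le_add_of_nonneg_left (leafAffinity_nonneg f t0 _)))
    refine ⟨.node i T0 T1, ?_, ?_⟩
    · rw [weightedCost_node, weightedCost_node, leafAffinity]
      linarith
    · rw [weightedError_node, ← sum_restrictBit_add i w]
      linarith

/-- If every distribution on `X` admits a tree trading affinity for cost at rate `lam`, then every
weight function on `X` admits a tree of error at most `1/6` and small cost. -/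
theorem exists_tree_of_tradeoff {X : Set (ι → Bool)} {f : (ι → Bool) → Bool} {lam : ℝ}
    (hlam : 0 ≤ lam)
    (H : ∀ ν : InputDist ι X, ∃ t : DTree ι L,
      leafAffinity f t ν.μ + lam * weightedCost ν.μ t < 1)
    (w : (ι → Bool) → ℝ) (hw : 0 ≤ w) (hX : ∀ x, x ∉ X → w x = 0) :
    ∃ T : DTree ι Bool, lam / 6 * weightedCost w T ≤ affinity f w ∧
      weightedError f w T ≤ 1 / 6 * ∑ x, w x := by
  induction hn : (Function.support w).ncard using Nat.strong_induction_on generalizing w with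
  | _ n ih =>
  subst hn
  have h1 := sideMass_nonneg (f := f) hw true
  have h0 := sideMass_nonneg (f := f) hw false
  by_cases hsmall : affinity f w ≤ 1 / 3 * ∑ x, w x
  · have key : ∀ b, weightedError f w (.leaf b) = sideMass f w (!b) := by
      intro b
      refine sum_congr rfl fun x _ => ?_
      cases b <;> cases f x <;> simp [DTree.out]
    have hmin := (two_mul_min_le_affinity (f := f) hw).trans hsmall
    have hcost : ∀ b, lam / 6 * weightedCost w (.leaf b : DTree ι Bool) ≤ affinity f w := by
      intro b
      simpa [weightedCost, DTree.cost] using affinity_nonneg f w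
    rcases le_total (sideMass f w true) (sideMass f w false) with h | h
    · rw [min_eq_left h] at hmin
      exact ⟨.leaf false, hcost _, by rw [key]; simp only [Bool.not_false]; linarith⟩
    · rw [min_eq_right h] at hmin
      exact ⟨.leaf true, hcost _, by rw [key]; simp only [Bool.not_true]; linarith⟩
  push Not at hsmall
  have hA : 0 < affinity f w :=
    lt_of_le_of_lt (mul_nonneg (by norm_num) (sum_nonneg fun x _ => hw x)) hsmall
  have hprod : 0 < sideMass f w true * sideMass f w false := by
    unfold affinity at hA
    exact Real.sqrt_pos.1 (by linarith)
  have h1' : 0 < sideMass f w true := h1.lt_of_ne' fun h => by simp [h] at hprod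
  have h0' : 0 < sideMass f w false := h0.lt_of_ne' fun h => by simp [h] at hprod
  have hpos : ∀ b, 0 < sideMass f w b := fun b => by cases b <;> assumption
  let c : Bool → ℝ := fun b => 1 / (2 * sideMass f w b)
  have hc : ∀ b, 0 ≤ c b := fun b => by have := hpos b; positivity
  let ν : InputDist ι X :=
    { μ := fun x => c (f x) * w x
      nonneg := fun x => mul_nonneg (hc _) (hw x)
      sum_one := by
        rw [← sideMass_add f]
        have h : ∀ b, sideMass f (fun x => c (f x) * w x) b = 1 / 2 := by
          intro b
          have : sideMass f (fun x => c (f x) * w x) b = c b * sideMass f w b := by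
            rw [sideMass, sideMass, mul_sum]
            refine sum_congr rfl fun x _ => ?_
            split_ifs with h <;> simp [h]
          rw [this]
          have := hpos b
          simp only [c]; field_simp
        rw [h, h]; norm_num
      supp := fun x hx => by simp [hX x hx] }
  obtain ⟨t, ht⟩ := H ν
  have hscale : affinity f w * leafAffinity f t ν.μ = leafAffinity f t w := by
    have : Real.sqrt (c true * c false) = 1 / affinity f w := by
      have : c true * c false = 1 / (2 ^ 2 * (sideMass f w true * sideMass f w false)) := by
        simp only [c]; field_simp
      rw [this, Real.sqrt_div zero_le_one, Real.sqrt_one, Real.sqrt_mul (by norm_num),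
        Real.sqrt_sq (by norm_num), affinity]
    have h2 : leafAffinity f t ν.μ = _ := leafAffinity_scale f c hc t w
    rw [h2, this]
    field_simp
  have hcost : weightedCost w t ≤ 2 * (∑ x, w x) * weightedCost ν.μ t := by
    rw [weightedCost, weightedCost, mul_sum]
    refine sum_le_sum fun x _ => ?_
    rw [← mul_assoc]
    refine mul_le_mul_of_nonneg_right ?_ (Nat.cast_nonneg _)
    have hb := hpos (f x)
    have hle : sideMass f w (f x) ≤ ∑ x, w x := by
      rw [← sideMass_add f]; cases f x <;> linarith
    have : w x = 2 * sideMass f w (f x) * (c (f x) * w x) := by simp only [c]; field_simp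
    calc w x = 2 * sideMass f w (f x) * (c (f x) * w x) := this
      _ ≤ _ := mul_le_mul_of_nonneg_right (by linarith) (mul_nonneg (hc _) (hw x))
  have hν : 0 ≤ weightedCost ν.μ t :=
    sum_nonneg fun x _ => mul_nonneg (ν.nonneg x) (Nat.cast_nonneg _)
  have hdrop : leafAffinity f t w < affinity f w := by
    rw [← hscale]
    have := mul_nonneg hlam hν
    nlinarith
  obtain ⟨T, hT, hT'⟩ := exists_graft (f := f) (κ := lam / 6) (c := 1 / 6) t w fun S hS => by
    have hsub : Function.support (S.indicator w) ⊆ Function.support w := by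
      rw [Set.support_indicator]; exact Set.inter_subset_right
    refine ih _ ?_ (S.indicator w) (fun x => Set.indicator_nonneg (fun y _ => hw y) x)
      (fun x hx => by simp [Set.indicator, hX x hx]) rfl
    refine Set.ncard_lt_ncard (hsub.ssubset_of_ne fun heq => ?_) (Set.toFinite _)
    have : S.indicator w = w := Set.indicator_eq_self.2 (by
      rw [← heq, Set.support_indicator]; exact Set.inter_subset_left)
    rw [this] at hS
    exact absurd hS (not_le.2 hdrop)
  refine ⟨T, hT.trans ?_, hT'⟩
  have e1 : lam / 6 * weightedCost w t ≤ lam / 6 * (2 * (∑ x, w x) * weightedCost ν.μ t) :=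
    mul_le_mul_of_nonneg_left hcost (by linarith)
  have e2 := mul_le_mul_of_nonneg_right hsmall.le (mul_nonneg hlam hν)
  have e3 := mul_le_mul_of_nonneg_left ht.le hA.le
  rw [mul_add, hscale] at e3
  linarith

theorem leafBias_queryAll (f : (ι → Bool) → Bool) (w : (ι → Bool) → ℝ) (x : ι → Bool) :
    leafBias f w (DTree.queryAll univ.toList) x = 0 ∨
      leafBias f w (DTree.queryAll univ.toList) x = 1 := by
  have hS : (DTree.queryAll (univ : Finset ι).toList).leafSet x = {x} := by
    rw [DTree.leafSet_queryAll]
    ext y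
    simp [funext_iff]
  rw [leafBias, hS]
  by_cases h : f x = true
  · rw [Set.inter_eq_left.2 (by simpa using h)]
    exact (eq_or_ne (mass w {x}) 0).imp (fun h => by rw [h, zero_div]) div_self
  · rw [Set.singleton_inter_eq_empty.2 (by simpa using h)]
    simp [mass]

/-- The algorithm querying all coordinates. -/
noncomputable def queryAllAlg (ι : Type) [Fintype ι] : RandAlg ι Unit where
  k := 1
  p _ := 1
  T _ := DTree.queryAll (univ : Finset ι).toList
  p_nonneg _ := zero_le_one
  p_sum := by simp

theorem helScoreAlg_queryAllAlg (f : (ι → Bool) → Bool) {w : (ι → Bool) → ℝ}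
    (hs : ∑ x, w x = 1) : helScoreAlg f w (queryAllAlg ι) = 1 := by
  have h : ∀ x, Real.sqrt (leafBias f w (DTree.queryAll univ.toList) x *
      (1 - leafBias f w (DTree.queryAll univ.toList) x)) = 0 := by
    intro x
    rcases leafBias_queryAll f w x with h | h <;> simp [h]
  rw [helScoreAlg, queryAllAlg, Fin.sum_univ_one]
  simp [h, hs]

theorem expCost_queryAllAlg {w : (ι → Bool) → ℝ} (hs : ∑ x, w x = 1) :
    expCost w (queryAllAlg ι) = Fintype.card ι := by
  rw [expCost, queryAllAlg, Fin.sum_univ_one]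
  simp [DTree.cost_queryAll, ← sum_mul, hs]

theorem expCost_nonneg_s14 {w : (ι → Bool) → ℝ} (hw : 0 ≤ w) (R : RandAlg ι L) : 0 ≤ expCost w R :=
  sum_nonneg fun j _ => mul_nonneg (R.p_nonneg j)
    (sum_nonneg fun x _ => mul_nonneg (hw x) (Nat.cast_nonneg _))

theorem bddAbove_sInf_expCost (X : Set (ι → Bool)) (f : (ι → Bool) → Bool) {γ : ℝ} (hγ : γ ≤ 1) :
    BddAbove (Set.range fun μ : InputDist ι X =>
      sInf {c | ∃ R : RandAlg ι Unit, γ ≤ helScoreAlg f μ.μ R ∧ expCost μ.μ R = c}) := by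
  refine ⟨Fintype.card ι, ?_⟩
  rintro _ ⟨μ, rfl⟩
  refine csInf_le ⟨0, ?_⟩ ⟨queryAllAlg ι, ?_, expCost_queryAllAlg μ.sum_one⟩
  · rintro _ ⟨R, -, rfl⟩
    exact expCost_nonneg_s14 μ.nonneg R
  · rwa [helScoreAlg_queryAllAlg f μ.sum_one]

theorem RmaxHel_nonneg (X : Set (ι → Bool)) (f : (ι → Bool) → Bool) (γ : ℝ) :
    0 ≤ RmaxHel X f γ := by
  refine Real.iSup_nonneg fun μ => Real.sInf_nonneg ?_
  rintro _ ⟨R, -, rfl⟩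
  exact expCost_nonneg_s14 μ.nonneg R

theorem exists_tree_affinity_add_cost_lt {X : Set (ι → Bool)} {f : (ι → Bool) → Bool} {δ B : ℝ}
    (hδ : 0 < δ) (hδ1 : δ ≤ 1) (hB : RmaxHel X f ((1 + δ) / 2) < B) (hB0 : 0 < B)
    (ν : InputDist ι X) :
    ∃ t : DTree ι Unit, leafAffinity f t ν.μ + δ / B * weightedCost ν.μ t < 1 := by
  have hγ : (1 + δ) / 2 ≤ 1 := by linarith
  have hlt := (le_ciSup (bddAbove_sInf_expCost X f hγ) ν).trans_lt hB
  have hne : {c | ∃ R : RandAlg ι Unit, (1 + δ) / 2 ≤ helScoreAlg f ν.μ R ∧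
      expCost ν.μ R = c}.Nonempty :=
    ⟨_, queryAllAlg ι, by rwa [helScoreAlg_queryAllAlg f ν.sum_one], rfl⟩
  obtain ⟨_, ⟨R, hR, rfl⟩, hRB⟩ := exists_lt_of_csInf_lt hne hlt
  rw [helScoreAlg_eq f ν.nonneg ν.sum_one] at hR
  by_contra! hcon
  have h1 : ∑ j, R.p j * 1 ≤
      ∑ j, R.p j * (leafAffinity f (R.T j) ν.μ + δ / B * weightedCost ν.μ (R.T j)) :=
    sum_le_sum fun j _ => mul_le_mul_of_nonneg_left (hcon _) (R.p_nonneg j)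
  have h2 : ∑ j, R.p j * (leafAffinity f (R.T j) ν.μ + δ / B * weightedCost ν.μ (R.T j)) =
      ∑ j, R.p j * leafAffinity f (R.T j) ν.μ + δ / B * expCost ν.μ R := by
    rw [expCost, mul_sum, ← sum_add_distrib]
    refine sum_congr rfl fun j _ => ?_
    rw [weightedCost]; ring
  have h3 : δ / B * expCost ν.μ R < δ := by
    calc δ / B * expCost ν.μ R < δ / B * B := mul_lt_mul_of_pos_left hRB (by positivity)
      _ = δ := by field_simp
  rw [h2] at h1
  simp only [mul_one, R.p_sum] at h1
  linarith

/-- Cutting off a tree adds at most the probability of a large cost to the error. -/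
theorem weightedError_truncate_le (f : (ι → Bool) → Bool) {w : (ι → Bool) → ℝ} (hw : 0 ≤ w)
    (T : DTree ι Bool) (d : ℕ) :
    weightedError f w (T.truncate d) ≤ weightedError f w T + weightedCost w T / (d + 1) := by
  rw [weightedError, weightedError, weightedCost, sum_div, ← sum_add_distrib]
  refine sum_le_sum fun x _ => ?_
  have hx : 0 ≤ w x := hw x
  by_cases h : T.cost x ≤ d
  · rw [DTree.out_truncate d T x h]
    exact le_add_of_nonneg_right (by positivity)
  · have hc : (d : ℝ) + 1 ≤ T.cost x := by exact_mod_cast not_le.1 h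
    have h1 : w x ≤ w x * T.cost x / (d + 1) := by
      rw [le_div_iff₀ (by positivity)]
      exact mul_le_mul_of_nonneg_left hc hx
    split_ifs <;> linarith

end Weights

/-- A minimax principle for finitely many payoff vectors. -/
theorem exists_mem_convexHull_of_forall_weights {σ κ : Type} [Fintype σ] [DecidableEq σ]
    [Nonempty κ] (X : Set σ) (v : κ → σ → ℝ) (hv : (Set.range v).Finite) (r : ℝ)
    (H : ∀ μ : σ → ℝ, (∀ x, 0 ≤ μ x) → ∑ x, μ x = 1 → (∀ x, x ∉ X → μ x = 0) →
      ∃ k, r ≤ ∑ x, μ x * v k x) :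
    ∃ y ∈ convexHull ℝ (Set.range v), ∀ x ∈ X, r ≤ y x := by
  by_contra! hcon
  set Q : Set (σ → ℝ) := {y | ∀ x ∈ X, r ≤ y x} with hQ
  have hQc : Convex ℝ Q := by
    intro a ha b hb s t hs ht hst x hx
    have h1 := mul_le_mul_of_nonneg_left (ha x hx) hs
    have h2 := mul_le_mul_of_nonneg_left (hb x hx) ht
    have h3 : s * r + t * r = r := by rw [← add_mul, hst, one_mul]
    simp only [Pi.add_apply, Pi.smul_apply, smul_eq_mul]
    linarith
  have hQcl : IsClosed Q := by
    have : Q = ⋂ x ∈ X, {y : σ → ℝ | r ≤ y x} := by ext y; simp [hQ]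
    rw [this]
    exact isClosed_biInter fun x _ => isClosed_le continuous_const (continuous_apply x)
  obtain ⟨g, u, u', hu, huu, hu'⟩ := geometric_hahn_banach_compact_closed
    (convex_convexHull ℝ (Set.range v)) (hv.isCompact_convexHull ℝ) hQc hQcl
    (Set.disjoint_left.2 fun y hy hyQ => by
      obtain ⟨x, hx, hlt⟩ := hcon y hy
      exact absurd (hyQ x hx) (not_le.2 hlt))
  set c : σ → ℝ := fun x => g (Pi.single x 1) with hc
  have hg : ∀ y, g y = ∑ x, c x * y x := by
    intro y
    have hy : y = ∑ x, y x • (Pi.single x 1 : σ → ℝ) := by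
      ext z; simp [Finset.sum_apply, Pi.single_apply]
    conv_lhs => rw [hy]
    simp [map_sum, hc, mul_comm]
  have hray : ∀ x (e : ℝ), (x ∈ X → 0 ≤ e) → 0 ≤ e * c x := by
    intro x e he
    by_contra! hneg
    set b0 : σ → ℝ := fun _ => r
    obtain ⟨n, hn⟩ := exists_nat_gt ((g b0 - u') / -(e * c x))
    rw [div_lt_iff₀ (by linarith)] at hn
    have hmem : b0 + (n * e) • (Pi.single x 1 : σ → ℝ) ∈ Q := by
      intro z hz
      by_cases hzx : z = x
      · subst hzx
        simpa [b0] using mul_nonneg n.cast_nonneg (he hz)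
      · simp [b0, hzx]
    have := hu' _ hmem
    rw [map_add, map_smul, smul_eq_mul] at this
    simp only [hc] at hn
    linarith
  have hc0 : ∀ x, 0 ≤ c x := fun x => by simpa using hray x 1 fun _ => zero_le_one
  have hcX : ∀ x, x ∉ X → c x = 0 := fun x hx => by
    have := hray x (-1) fun h => absurd h hx
    linarith [hc0 x]
  obtain ⟨k0⟩ := ‹Nonempty κ›
  have hgv : ∀ k, g (v k) < u := fun k => hu _ (subset_convexHull ℝ _ ⟨k, rfl⟩)
  have hgr : u' < r * ∑ x, c x := by
    have := hu' (fun _ => r) fun x _ => le_rfl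
    rwa [hg, ← sum_mul, mul_comm] at this
  have hs : 0 < ∑ x, c x := by
    refine (sum_nonneg fun x _ => hc0 x).lt_of_ne' fun h0 => ?_
    have hz := (sum_eq_zero_iff_of_nonneg fun x _ => hc0 x).1 h0
    have := hgv k0
    rw [hg, sum_eq_zero fun x hx => by rw [hz x hx, zero_mul]] at this
    rw [h0] at hgr
    linarith
  obtain ⟨k, hk⟩ := H (fun x => c x / ∑ x, c x) (fun x => div_nonneg (hc0 x) hs.le)
    (by rw [← sum_div, div_self hs.ne']) (fun x hx => by rw [hcX x hx, zero_div])
  have h1 : ∑ x, c x / (∑ x, c x) * v k x = g (v k) / ∑ x, c x := by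
    rw [hg, sum_div]
    exact sum_congr rfl fun x _ => by ring
  rw [h1, le_div_iff₀ hs] at hk
  linarith [hgv k]

/-- Distributional algorithms of depth `d` and error `1 - r` give a worst-case algorithm. -/
theorem Rwc_le_of_forall_inputDist {ι : Type} [Fintype ι] [DecidableEq ι] (X : Set (ι → Bool))
    (f : (ι → Bool) → Bool) (r : ℝ) (d : ℕ)
    (H : ∀ μ : InputDist ι X, ∃ T : DTree ι Bool, T.depth ≤ d ∧
      weightedError f μ.μ T ≤ 1 - r) :
    Rwc X f r ≤ d := by
  let v : {T : DTree ι Bool // T.depth ≤ d} → (ι → Bool) → ℝ :=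
    fun T x => if T.1.out x = f x then 1 else 0
  have hfin : (Set.range v).Finite := by
    refine Set.Finite.subset (Set.Finite.pi' fun _ => Set.toFinite ({0, 1} : Set ℝ)) ?_
    rintro _ ⟨T, rfl⟩ x
    simp only [v]
    split_ifs <;> simp
  have : Nonempty {T : DTree ι Bool // T.depth ≤ d} := ⟨⟨.leaf true, Nat.zero_le _⟩⟩
  obtain ⟨y, hy, hyX⟩ := exists_mem_convexHull_of_forall_weights X v hfin r
    fun μ h0 h1 hX => by
      obtain ⟨T, hT, hE⟩ := H ⟨μ, h0, h1, hX⟩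
      refine ⟨⟨T, hT⟩, ?_⟩
      have : ∑ x, μ x * v ⟨T, hT⟩ x = 1 - weightedError f μ T := by
        rw [← h1, weightedError, ← sum_sub_distrib]
        refine sum_congr rfl fun x _ => ?_
        simp only [v]
        split_ifs <;> simp
      rw [this]
      simp only at hE
      linarith
  obtain ⟨τ, _, p, z, hp0, hp1, hz, hsum⟩ := mem_convexHull_iff_exists_fintype.1 hy
  choose T hT using hz
  let e := Fintype.equivFin τ
  let R : RandAlg ι Bool :=
    { k := Fintype.card τ
      p := fun j => p (e.symm j)
      T := fun j => (T (e.symm j)).1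
      p_nonneg := fun j => hp0 _
      p_sum := by rw [e.symm.sum_comp p, hp1] }
  refine Nat.sInf_le ⟨R, fun j _ => DTree.allLabels_true _, fun x hx => ?_, fun j _ => (T _).2⟩
  refine (hyX x hx).trans_eq ?_
  rw [← hsum, Finset.sum_apply]
  refine (e.symm.sum_comp _).symm.trans (sum_congr rfl fun j _ => ?_)
  rw [← hT]
  by_cases h : (T (e.symm j)).1.out x = f x <;> simp [R, v, h]

/-- **Linear amplification for the Hellinger score**: there is a universal constant `C`
such that `R(f) ≤ (C/δ)·R̄̄_{Hel,(1+δ)/2}(f)`. -/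
theorem hellinger_linear_amplification :
    ∃ C : ℝ, 0 < C ∧
      ∀ (m : ℕ) (X : Set (Fin m → Bool)) (f : (Fin m → Bool) → Bool) (δ : ℝ),
        0 < δ → δ ≤ 1 →
        (Rwc X f (2 / 3) : ℝ) ≤ (C / δ) * RmaxHel X f ((1 + δ) / 2) := by
  refine ⟨36, by norm_num, fun m X f δ hδ hδ1 => ?_⟩
  set r := RmaxHel X f ((1 + δ) / 2) with hr
  have hr0 : 0 ≤ r := RmaxHel_nonneg X f _
  set d := ⌊36 / δ * r⌋₊
  refine le_trans (Nat.cast_le.2 ?_) (Nat.floor_le (by positivity : 0 ≤ 36 / δ * r))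
  have hd : 36 / δ * r < (d : ℝ) + 1 := Nat.lt_floor_add_one _
  set B : ℝ := δ * (d + 1) / 36 with hBdef
  have hB0 : 0 < B := by positivity
  have hB : r < B := by
    rw [div_mul_eq_mul_div, div_lt_iff₀ hδ] at hd
    linarith
  refine Rwc_le_of_forall_inputDist X f _ d fun μ => ?_
  obtain ⟨T, hcost, herr⟩ := exists_tree_of_tradeoff (by positivity)
    (exists_tree_affinity_add_cost_lt hδ hδ1 hB hB0) μ.μ μ.nonneg μ.supp
  refine ⟨T.truncate d, T.depth_truncate_le d, ?_⟩
  have h1 := weightedError_truncate_le f μ.nonneg T d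
  have h2 := hcost.trans (affinity_le μ.nonneg)
  have h3 : δ / B / 6 * weightedCost μ.μ T = 6 * (weightedCost μ.μ T / (d + 1)) := by
    rw [hBdef]; field_simp; norm_num
  rw [h3, μ.sum_one] at h2
  rw [μ.sum_one] at herr
  linarith
end
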